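/- Let a<b be reals and V1,V2 ∈ C²((0,1)) be continuous at 0 and 1. Assume the functions W1(p)=V1(p)−log(p(1−p)) and W2(p)=V2(p)−log(p(1−p)) have unique minimizers p1* ∈ (0,1) and p2* ∈ (0,1), respectively. Let (X^(n))_{n≥1} be random vectors on a common probability space with X^(n) distributed according to ℙ_{n,[a,b],V1,V2}. Then for every fixed k ≥ 1, the vector (X^(n)_1,…,X^(n)_k) of the first k coordinates converges, as n→∞, almost surely and in L¹ to (m1*,…,mk*), where mj* = ∫ x^j dμ_{a,b,p1*,p2*}(x) are the first k moments of the measure μ_{a,b,p1*,p2*}. -/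

import Mathlib

open MeasureTheory Real Filter Topology Polynomial

noncomputable section
/-- `l₋` for the measure `μ_{a,b,p1,p2}`. -/
def lmin (a b p1 p2 : ℝ) : ℝ :=
  a + (b - a) * (Real.sqrt (p1 * (1 - p2)) - Real.sqrt (p2 * (1 - p1))) ^ 2

/-- `l₊` for the measure `μ_{a,b,p1,p2}`. -/
def lmax (a b p1 p2 : ℝ) : ℝ :=
  a + (b - a) * (Real.sqrt (p1 * (1 - p2)) + Real.sqrt (p2 * (1 - p1))) ^ 2

/-- Density of the absolutely continuous part of `μ_{a,b,p1,p2}`. -/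
def compactDensity (a b p1 p2 : ℝ) (x : ℝ) : ℝ :=
  if x ∈ Set.Icc (lmin a b p1 p2) (lmax a b p1 p2) then
    Real.sqrt ((x - lmin a b p1 p2) * (lmax a b p1 p2 - x)) /
      (2 * π * p2 * (x - a) * (b - x))
  else 0

/-- The measure `μ_{a,b,p1,p2}` (free binomial / Kesten-McKay measure). -/
def muCompact (a b p1 p2 : ℝ) : Measure ℝ :=
  volume.withDensity (fun x => ENNReal.ofReal (compactDensity a b p1 p2 x))
    + ENNReal.ofReal (max (1 - p1 / p2) 0) • Measure.dirac a
    + ENNReal.ofReal (max ((p1 + p2 - 1) / p2) 0) • Measure.dirac b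
/-- The `n`-th moment space of Borel probability measures supported on `E ⊆ ℝ`
with all moments finite. -/
def momentSpace (E : Set ℝ) (n : ℕ) : Set (Fin n → ℝ) :=
  {v | ∃ μ : Measure ℝ, IsProbabilityMeasure μ ∧ μ Eᶜ = 0 ∧
      (∀ j : ℕ, Integrable (fun x => x ^ j) μ) ∧
      ∀ j : Fin n, v j = ∫ x, x ^ ((j : ℕ) + 1) ∂μ}
/-- The set of possible values for the `k`-th moment of a probability measure on `[a,b]`,
given that its moments of order `< k` agree with the corresponding entries of `v`. -/
def momentSection (a b : ℝ) {n : ℕ} (v : Fin n → ℝ) (k : ℕ) : Set ℝ :=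
  {m | ∃ μ : Measure ℝ, IsProbabilityMeasure μ ∧ μ (Set.Icc a b)ᶜ = 0 ∧
      (∀ i : Fin n, (i : ℕ) + 1 < k → ∫ x, x ^ ((i : ℕ) + 1) ∂μ = v i) ∧
      m = ∫ x, x ^ k ∂μ}

/-- The `(j+1)`-st canonical moment (`1`-based index `j+1`) of a point of the moment space
`M_n([a,b])`. -/
def canCompact (a b : ℝ) {n : ℕ} (v : Fin n → ℝ) (j : Fin n) : ℝ :=
  (v j - sInf (momentSection a b v ((j : ℕ) + 1))) /
    (sSup (momentSection a b v ((j : ℕ) + 1)) - sInf (momentSection a b v ((j : ℕ) + 1)))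

/-- The (unnormalized) density of `ℙ_{n,[a,b],V₁,V₂}` in terms of canonical moments:
odd (1-based) canonical moments get the potential `V₁`, even ones `V₂`. -/
def canDensityC (a b : ℝ) (V1 V2 : ℝ → ℝ) {n : ℕ} (v : Fin n → ℝ) : ℝ :=
  Real.exp (-(n : ℝ) * ∑ j : Fin n,
    (if (j : ℕ) % 2 = 0 then V1 (canCompact a b v j) else V2 (canCompact a b v j)))

/-- `P` is the distribution `ℙ_{n,[a,b],V₁,V₂}`: a probability measure giving no mass to the
boundary of the moment space and with Lebesgue density on the interior proportional to
`exp[-n Σ V₁(p_odd) - n Σ V₂(p_even)]`. -/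
def isCompactDist (a b : ℝ) (V1 V2 : ℝ → ℝ) (n : ℕ) (P : Measure (Fin n → ℝ)) : Prop :=
  IsProbabilityMeasure P ∧ ∃ Z : ℝ, 0 < Z ∧
    P = (ENNReal.ofReal Z)⁻¹ •
      ((volume.restrict (interior (momentSpace (Set.Icc a b) n))).withDensity
        (fun v => ENNReal.ofReal (canDensityC a b V1 V2 v)))

namespace CanonicalMoments

/-! ### Moment sequences parametrized by canonical moments -/

/-- The chain sequence `ζ` attached to a sequence of canonical moments (all indices shifted to
start at `0`). -/
def zeta (p : ℕ → ℝ) : ℕ → ℝ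
  | 0 => p 0
  | n + 1 => (1 - p n) * p (n + 1)

/-- The weighted count of Dyck paths of length `k` ending at height `n`, where a down step to
height `n` has weight `zeta p n`. -/
def dyck (p : ℕ → ℝ) : ℕ → ℕ → ℝ
  | 0, 0 => 1
  | 0, _ + 1 => 0
  | k + 1, 0 => dyck p k 1
  | k + 1, n + 1 => dyck p k (n + 2) + zeta p n * dyck p k n

/-- The `j`-th moment on `[0,1]` with canonical moments `p`. -/
def unitMoment (p : ℕ → ℝ) (j : ℕ) : ℝ := dyck p (2 * j) 0

/-- The orthogonal polynomials of the symmetric functional with recurrence coefficients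
`zeta p`. -/
def orthPoly (p : ℕ → ℝ) : ℕ → ℝ[X]
  | 0 => 1
  | 1 => X
  | n + 2 => X * orthPoly p (n + 1) - C (zeta p n) * orthPoly p n

/-- The orthogonal polynomials after multiplication of the functional by `1 - X ^ 2`. -/
def dualPoly (p : ℕ → ℝ) : ℕ → ℝ[X]
  | 0 => 1
  | 1 => X
  | n + 2 => X * dualPoly p (n + 1) - C (p n * (1 - p (n + 1))) * dualPoly p n

/-- The linear functional on polynomials with moments `c`. -/
def momentFunctional (c : ℕ → ℝ) : ℝ[X] →ₗ[ℝ] ℝ :=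
  Polynomial.lsum fun k => c k • LinearMap.id

lemma momentFunctional_X_pow (c : ℕ → ℝ) (k : ℕ) : momentFunctional c (X ^ k) = c k := by
  simp [momentFunctional, ← Polynomial.monomial_one_right_eq_X_pow]

lemma momentFunctional_ext {L : ℝ[X] →ₗ[ℝ] ℝ} {c : ℕ → ℝ} (h : ∀ k, L (X ^ k) = c k) :
    L = momentFunctional c := by
  refine Polynomial.lhom_ext' fun k => LinearMap.ext_ring ?_
  simp only [LinearMap.comp_apply, Polynomial.monomial_one_right_eq_X_pow]
  rw [h, momentFunctional_X_pow]

lemma momentFunctional_eq_sum (c : ℕ → ℝ) (f : ℝ[X]) {d : ℕ} (hd : f.natDegree ≤ d) :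
    momentFunctional c f = ∑ k ∈ Finset.range (d + 1), f.coeff k * c k := by
  conv_lhs => rw [f.as_sum_range' (d + 1) (by omega)]
  simp only [map_sum, ← Polynomial.C_mul_X_pow_eq_monomial, ← Polynomial.smul_eq_C_mul, map_smul,
    momentFunctional_X_pow, smul_eq_mul]

lemma momentFunctional_sub_of_monic {c c' : ℕ → ℝ} {f : ℝ[X]} {d : ℕ} (hf : f.Monic)
    (hd : f.natDegree = d) (h : ∀ k < d, c k = c' k) :
    momentFunctional c f - momentFunctional c' f = c d - c' d := by
  rw [momentFunctional_eq_sum c f hd.le, momentFunctional_eq_sum c' f hd.le,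
    Finset.sum_range_succ, Finset.sum_range_succ,
    Finset.sum_congr rfl fun k hk => by rw [h k (Finset.mem_range.1 hk)]]
  have : f.coeff d = 1 := by rw [← hd]; exact hf
  rw [this]; ring

lemma dyck_eq_zero (p : ℕ → ℝ) : ∀ {k n : ℕ}, k < n → dyck p k n = 0
  | 0, n + 1, _ => by simp [dyck]
  | k + 1, n + 1, h => by
    rw [dyck, dyck_eq_zero p (by omega), dyck_eq_zero p (by omega)]; simp

lemma dyck_self (p : ℕ → ℝ) : ∀ n : ℕ, dyck p n n = ∏ i ∈ Finset.range n, zeta p i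
  | 0 => by simp [dyck]
  | n + 1 => by
    rw [dyck, dyck_eq_zero p (by omega), dyck_self p n, Finset.prod_range_succ]; ring

lemma dyck_odd (p : ℕ → ℝ) : ∀ {k n : ℕ}, Odd (k + n) → dyck p k n = 0
  | 0, 0, h => by simp at h
  | 0, n + 1, _ => by simp [dyck]
  | k + 1, 0, h => by rw [dyck, dyck_odd p (by simpa using h)]
  | k + 1, n + 1, h => by
    have h' : Odd (k + n) := by
      have : k + 1 + (n + 1) = (k + n) + 2 := by ring
      rw [this] at h
      simpa [parity_simps] using h
    rw [dyck, dyck_odd p (k := k) (n := n) h', dyck_odd p (k := k) (n := n + 2)]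
    · simp
    · rw [← add_assoc]; simpa [parity_simps] using h'

lemma zeta_congr {p p' : ℕ → ℝ} {m : ℕ} (h : ∀ i < m, p i = p' i) :
    ∀ {n : ℕ}, n < m → zeta p n = zeta p' n
  | 0, hn => h 0 hn
  | n + 1, hn => by simp only [zeta, h n (by omega), h (n + 1) hn]

lemma dyck_congr {p p' : ℕ → ℝ} {m : ℕ} (h : ∀ i < m, p i = p' i) :
    ∀ {k n : ℕ}, k + n < 2 * m + 2 → dyck p k n = dyck p' k n
  | 0, 0, _ => by simp [dyck]
  | 0, n + 1, _ => by simp [dyck]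
  | k + 1, 0, hk => by rw [dyck, dyck, dyck_congr h (by omega)]
  | k + 1, n + 1, hk => by
    rw [dyck, dyck, dyck_congr h (k := k) (n := n + 2) (by omega)]
    by_cases hn : n ≤ k
    · rw [zeta_congr h (n := n) (by omega), dyck_congr h (k := k) (n := n) (by omega)]
    · rw [dyck_eq_zero p (by omega), dyck_eq_zero p' (k := k) (n := n) (by omega)]; simp

lemma unitMoment_congr {p p' : ℕ → ℝ} {j : ℕ} (h : ∀ i < j, p i = p' i) :
    unitMoment p j = unitMoment p' j :=
  dyck_congr h (by omega)

lemma unitMoment_zero (p : ℕ → ℝ) : unitMoment p 0 = 1 := rfl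

lemma orthPoly_congr {p p' : ℕ → ℝ} {m : ℕ} (h : ∀ i < m, p i = p' i) :
    ∀ {n : ℕ}, n ≤ m + 1 → orthPoly p n = orthPoly p' n
  | 0, _ => rfl
  | 1, _ => rfl
  | n + 2, hn => by
    rw [orthPoly, orthPoly, orthPoly_congr h (n := n + 1) (by omega),
      orthPoly_congr h (n := n) (by omega), zeta_congr h (n := n) (by omega)]

lemma monic_and_natDegree_of_recurrence {f : ℕ → ℝ[X]} {c : ℕ → ℝ} (h0 : f 0 = 1) (h1 : f 1 = X)
    (h : ∀ n, f (n + 2) = X * f (n + 1) - C (c n) * f n) :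
    ∀ n, (f n).Monic ∧ (f n).natDegree = n
  | 0 => by simp [h0]
  | 1 => by simp [h1, monic_X]
  | n + 2 => by
    obtain ⟨hm, hd⟩ := monic_and_natDegree_of_recurrence h0 h1 h (n + 1)
    obtain ⟨-, hd'⟩ := monic_and_natDegree_of_recurrence h0 h1 h n
    have hm' : (X * f (n + 1)).Monic := monic_X.mul hm
    have hdm : (X * f (n + 1)).natDegree = n + 2 := by
      rw [monic_X.natDegree_mul hm, hd, natDegree_X]; ring
    have hlt : (C (c n) * f n).natDegree < (X * f (n + 1)).natDegree := by
      have := natDegree_C_mul_le (c n) (f n)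
      omega
    rw [h]
    refine ⟨hm'.sub_of_left ?_, ?_⟩
    · exact degree_lt_degree hlt
    · rw [natDegree_sub_eq_left_of_natDegree_lt hlt, hdm]

lemma orthPoly_monic (p : ℕ → ℝ) (n : ℕ) : (orthPoly p n).Monic :=
  (monic_and_natDegree_of_recurrence rfl rfl (fun _ => rfl) n).1

lemma orthPoly_natDegree (p : ℕ → ℝ) (n : ℕ) : (orthPoly p n).natDegree = n :=
  (monic_and_natDegree_of_recurrence (f := orthPoly p) rfl rfl (fun _ => rfl) n).2

lemma dualPoly_monic (p : ℕ → ℝ) (n : ℕ) : (dualPoly p n).Monic :=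
  (monic_and_natDegree_of_recurrence (c := fun n => p n * (1 - p (n + 1))) rfl rfl
    (fun _ => rfl) n).1

lemma dualPoly_natDegree (p : ℕ → ℝ) (n : ℕ) : (dualPoly p n).natDegree = n :=
  (monic_and_natDegree_of_recurrence (f := dualPoly p) (c := fun n => p n * (1 - p (n + 1)))
    rfl rfl (fun _ => rfl) n).2

lemma dualPoly_zero_mul (p : ℕ → ℝ) :
    (X ^ 2 - 1) * dualPoly p 0 = orthPoly p 2 - C (1 - p 0) * orthPoly p 0 := by
  simp only [dualPoly, orthPoly, zeta, C_sub, C_1]; ring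

lemma dualPoly_succ_mul (p : ℕ → ℝ) :
    ∀ n, (X ^ 2 - 1) * dualPoly p (n + 1) =
      orthPoly p (n + 3) - C ((1 - p n) * (1 - p (n + 1))) * orthPoly p (n + 1)
  | 0 => by
    simp only [dualPoly, orthPoly, zeta, C_sub, C_1, C_mul]; ring
  | 1 => by
    simp only [dualPoly, orthPoly, zeta, C_sub, C_1, C_mul]; ring
  | n + 2 => by
    have h1 := dualPoly_succ_mul p (n + 1)
    have h2 := dualPoly_succ_mul p n
    rw [dualPoly, orthPoly, zeta]
    have e1 : orthPoly p (n + 1 + 3) =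
        X * orthPoly p (n + 3) - C (zeta p (n + 2)) * orthPoly p (n + 2) := rfl
    have e2 : orthPoly p (n + 3) =
        X * orthPoly p (n + 2) - C (zeta p (n + 1)) * orthPoly p (n + 1) := rfl
    have e3 : orthPoly p (n + 2 + 2) =
        X * orthPoly p (n + 3) - C (zeta p (n + 2)) * orthPoly p (n + 2) := rfl
    simp only [zeta, C_sub, C_1, C_mul] at *
    linear_combination X * h1 - C (p (n + 1)) * (1 - C (p (n + 1 + 1))) * h2 + X * e1 - X * e3
      + (1 - C (p (n + 1))) * (1 - C (p (n + 2))) * e2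

lemma momentFunctional_X_pow_mul_orthPoly (p : ℕ → ℝ) :
    ∀ n k : ℕ, momentFunctional (dyck p · 0) (X ^ k * orthPoly p n) = dyck p k n
  | 0, k => by simp [orthPoly, momentFunctional_X_pow]
  | 1, k => by rw [orthPoly, ← pow_succ, momentFunctional_X_pow, dyck]
  | n + 2, k => by
    have h1 := momentFunctional_X_pow_mul_orthPoly p (n + 1) (k + 1)
    have h2 := momentFunctional_X_pow_mul_orthPoly p n k
    have : (X ^ k * orthPoly p (n + 2) : ℝ[X]) =
        X ^ (k + 1) * orthPoly p (n + 1) - zeta p n • (X ^ k * orthPoly p n) := by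
      rw [orthPoly, smul_eq_C_mul]; ring
    rw [this, map_sub, map_smul, h1, h2, dyck, smul_eq_mul]; ring

lemma momentFunctional_mul_orthPoly (p : ℕ → ℝ) (n : ℕ) (g : ℝ[X]) :
    momentFunctional (dyck p · 0) (g * orthPoly p n) = momentFunctional (dyck p · n) g := by
  have : (momentFunctional (dyck p · 0)).comp (LinearMap.mulRight ℝ (orthPoly p n)) =
      momentFunctional (dyck p · n) :=
    momentFunctional_ext fun k => by
      simpa using momentFunctional_X_pow_mul_orthPoly p n k
  simpa using congrArg (fun L => L g) this

lemma momentFunctional_mul_orthPoly_of_lt (p : ℕ → ℝ) {n : ℕ} {g : ℝ[X]} (hg : g.natDegree < n) :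
    momentFunctional (dyck p · 0) (g * orthPoly p n) = 0 := by
  rw [momentFunctional_mul_orthPoly, momentFunctional_eq_sum _ g le_rfl]
  refine Finset.sum_eq_zero fun k hk => ?_
  rw [Finset.mem_range] at hk
  simp [dyck_eq_zero p (show k < n by omega)]

lemma momentFunctional_mul_orthPoly_of_monic (p : ℕ → ℝ) {n : ℕ} {g : ℝ[X]} (hg : g.Monic)
    (hd : g.natDegree = n) :
    momentFunctional (dyck p · 0) (g * orthPoly p n) = ∏ i ∈ Finset.range n, zeta p i := by
  rw [momentFunctional_mul_orthPoly, momentFunctional_eq_sum _ g hd.le, Finset.sum_range_succ,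
    Finset.sum_eq_zero fun k hk => by
      rw [dyck_eq_zero p (Finset.mem_range.1 hk), mul_zero],
    dyck_self, ← hd, hg.coeff_natDegree]
  simp

/-- The length of the `n`-th moment range on `[0,1]`. -/
def unitRange (p : ℕ → ℝ) (n : ℕ) : ℝ := ∏ i ∈ Finset.range n, p i * (1 - p i)

lemma unitRange_congr {p p' : ℕ → ℝ} {n : ℕ} (h : ∀ i < n, p i = p' i) :
    unitRange p n = unitRange p' n :=
  Finset.prod_congr rfl fun i hi => by rw [h i (Finset.mem_range.1 hi)]

lemma prod_zeta (p : ℕ → ℝ) (n : ℕ) :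
    ∏ i ∈ Finset.range (n + 1), zeta p i = unitRange p n * p n := by
  induction n with
  | zero => simp [zeta, unitRange]
  | succ n ih =>
    rw [Finset.prod_range_succ, ih, unitRange, unitRange, Finset.prod_range_succ, zeta]; ring

lemma momentFunctional_orthPoly_sq (p : ℕ → ℝ) (n : ℕ) :
    momentFunctional (dyck p · 0) (orthPoly p (n + 1) * orthPoly p (n + 1)) =
      unitRange p n * p n := by
  rw [momentFunctional_mul_orthPoly_of_monic p (orthPoly_monic p _) (orthPoly_natDegree p _),
    prod_zeta]

lemma momentFunctional_dualPoly_sq (p : ℕ → ℝ) (n : ℕ) :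
    momentFunctional (dyck p · 0) ((X ^ 2 - 1) * (dualPoly p n * dualPoly p n)) =
      -(unitRange p n * (1 - p n)) := by
  have key : ∀ c : ℝ, (X ^ 2 - 1) * dualPoly p n = orthPoly p (n + 2) - C c * orthPoly p n →
      momentFunctional (dyck p · 0) ((X ^ 2 - 1) * (dualPoly p n * dualPoly p n)) =
        -(c * ∏ i ∈ Finset.range n, zeta p i) := fun c h => by
    have : (X ^ 2 - 1) * (dualPoly p n * dualPoly p n) =
        dualPoly p n * orthPoly p (n + 2) - c • (dualPoly p n * orthPoly p n) := by
      rw [← mul_assoc, h, smul_eq_C_mul]; ring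
    rw [this, map_sub, map_smul,
      momentFunctional_mul_orthPoly_of_lt p (by rw [dualPoly_natDegree]; omega),
      momentFunctional_mul_orthPoly_of_monic p (dualPoly_monic p n) (dualPoly_natDegree p n)]
    simp
  cases n with
  | zero => rw [key _ (dualPoly_zero_mul p)]; simp [unitRange]
  | succ n =>
    rw [key _ (dualPoly_succ_mul p n), prod_zeta, unitRange, unitRange, Finset.prod_range_succ]
    ring

lemma unitMoment_succ_sub {p p' : ℕ → ℝ} {j : ℕ} (h : ∀ i < j, p i = p' i) :
    unitMoment p (j + 1) - unitMoment p' (j + 1) = unitRange p j * (p j - p' j) := by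
  have hQ : orthPoly p (j + 1) = orthPoly p' (j + 1) := orthPoly_congr h le_rfl
  have h1 := momentFunctional_orthPoly_sq p j
  have h2 := momentFunctional_orthPoly_sq p' j
  rw [← hQ] at h2
  have := momentFunctional_sub_of_monic (c := (dyck p · 0)) (c' := (dyck p' · 0))
    (f := orthPoly p (j + 1) * orthPoly p (j + 1)) (d := 2 * (j + 1))
    ((orthPoly_monic p _).mul (orthPoly_monic p _))
    (by rw [(orthPoly_monic p _).natDegree_mul (orthPoly_monic p _), orthPoly_natDegree]; ring)
    (fun k hk => dyck_congr h (by omega))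
  rw [unitMoment, unitMoment, ← this, h1, h2, unitRange_congr h]
  ring

/-- The moments of the symmetrized square root of a measure with moments `c`. -/
def symMoment (c : ℕ → ℝ) (k : ℕ) : ℝ := if Even k then c (k / 2) else 0

lemma symMoment_eq_dyck {p c : ℕ → ℝ} {j : ℕ} (h : ∀ i ≤ j, c i = unitMoment p i) {k : ℕ}
    (hk : k < 2 * (j + 1)) : symMoment c k = dyck p k 0 := by
  unfold symMoment
  split_ifs with hev
  · obtain ⟨i, rfl⟩ := hev
    rw [h _ (by omega), unitMoment]
    congr 1
    omega
  · rw [dyck_odd p (by simpa using hev)]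

/-- Bounds for the next moment, for a sequence whose symmetrized functional is nonnegative on
polynomials nonnegative on `[-1, 1]`. -/
lemma next_moment_bounds {p c : ℕ → ℝ} {j : ℕ} (h : ∀ i ≤ j, c i = unitMoment p i)
    (hpos : ∀ f : ℝ[X], (∀ x ∈ Set.Icc (-1 : ℝ) 1, 0 ≤ f.eval x) →
      0 ≤ momentFunctional (symMoment c) f) :
    unitMoment p (j + 1) - unitRange p j * p j ≤ c (j + 1) ∧
      c (j + 1) ≤ unitMoment p (j + 1) + unitRange p j * (1 - p j) := by
  have hc : symMoment c (2 * (j + 1)) = c (j + 1) := by simp [symMoment]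
  have key : ∀ f : ℝ[X], f.Monic → f.natDegree = 2 * (j + 1) →
      momentFunctional (symMoment c) f - momentFunctional (dyck p · 0) f =
        c (j + 1) - unitMoment p (j + 1) := fun f hf hd => by
    rw [momentFunctional_sub_of_monic hf hd fun k hk => symMoment_eq_dyck h hk, hc, unitMoment]
  constructor
  · have h1 := key (orthPoly p (j + 1) * orthPoly p (j + 1))
      ((orthPoly_monic p _).mul (orthPoly_monic p _))
      (by rw [(orthPoly_monic p _).natDegree_mul (orthPoly_monic p _), orthPoly_natDegree]; ring)
    have h2 := hpos (orthPoly p (j + 1) * orthPoly p (j + 1))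
      (fun x _ => by rw [eval_mul]; exact mul_self_nonneg _)
    rw [momentFunctional_orthPoly_sq] at h1
    linarith
  · have hm : (X ^ 2 - 1 : ℝ[X]).Monic := by
      simpa using monic_X_pow_sub_C (1 : ℝ) (n := 2) (by norm_num)
    have hmd : (X ^ 2 - 1 : ℝ[X]).natDegree = 2 := by
      simpa using natDegree_X_pow_sub_C (n := 2) (r := (1 : ℝ))
    have hS := (dualPoly_monic p j).mul (dualPoly_monic p j)
    have h1 := key ((X ^ 2 - 1) * (dualPoly p j * dualPoly p j)) (hm.mul hS)
      (by
        rw [hm.natDegree_mul hS, (dualPoly_monic p _).natDegree_mul (dualPoly_monic p _),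
          dualPoly_natDegree, hmd]; ring)
    have h2 := hpos (-((X ^ 2 - 1) * (dualPoly p j * dualPoly p j))) (fun x hx => by
      have : x ^ 2 ≤ 1 := by nlinarith [hx.1, hx.2]
      simp only [eval_neg, eval_mul, eval_sub, eval_pow, eval_X, eval_one]
      nlinarith [mul_self_nonneg ((dualPoly p j).eval x)])
    rw [map_neg] at h2
    rw [momentFunctional_dualPoly_sq] at h1
    linarith

/-! ### Spectral measures of Jacobi matrices -/

lemma exists_unit_measure_of_isHermitian {N : ℕ} {A : Matrix (Fin N) (Fin N) ℝ}
    (hA : A.IsHermitian) (hA1 : ∀ v : Fin N → ℝ, |v ⬝ᵥ A.mulVec v| ≤ v ⬝ᵥ v) (i₀ : Fin N) :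
    ∃ μ : Measure ℝ, IsProbabilityMeasure μ ∧ μ (Set.Icc 0 1)ᶜ = 0 ∧
      ∀ j : ℕ, ∫ x, x ^ j ∂μ = (A ^ (2 * j)) i₀ i₀ := by
  classical
  set U : Matrix (Fin N) (Fin N) ℝ := (hA.eigenvectorUnitary : Matrix (Fin N) (Fin N) ℝ)
  set l := hA.eigenvalues
  have hpow : ∀ k, (A ^ k) i₀ i₀ = ∑ i, (U i₀ i) ^ 2 * l i ^ k := fun k => by
    conv_lhs => rw [hA.spectral_theorem, ← map_pow, Unitary.conjStarAlgAut_apply,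
      Matrix.diagonal_pow]
    rw [Matrix.mul_apply]
    refine Finset.sum_congr rfl fun i _ => ?_
    rw [Matrix.mul_diagonal, Matrix.star_apply]
    simp only [Pi.pow_apply, Function.comp_apply, star_trivial, RCLike.ofReal_real_eq_id, id]
    ring
  have hl : ∀ i, |l i| ≤ 1 := fun i => by
    have h1 := hA1 (hA.eigenvectorBasis i)
    rw [hA.mulVec_eigenvectorBasis i, dotProduct_smul] at h1
    have h2 : (hA.eigenvectorBasis i).ofLp ⬝ᵥ (hA.eigenvectorBasis i).ofLp = 1 := by
      have := hA.eigenvectorBasis.orthonormal.1 i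
      rw [EuclideanSpace.norm_eq, Real.sqrt_eq_one] at this
      rw [← this]
      simp [dotProduct, sq]
    rw [h2] at h1
    simpa using h1
  have hfin : ∀ j : ℕ, ∫ x, x ^ j ∂(∑ i, ENNReal.ofReal ((U i₀ i) ^ 2) • Measure.dirac (l i ^ 2)) =
      (A ^ (2 * j)) i₀ i₀ := fun j => by
    rw [integral_finsetSum_measure fun i _ => (integrable_dirac (by simp)).smul_measure (by simp),
      hpow]
    refine Finset.sum_congr rfl fun i _ => ?_
    rw [integral_smul_measure, integral_dirac, ENNReal.toReal_ofReal (sq_nonneg _), smul_eq_mul,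
      pow_mul]
  refine ⟨∑ i, ENNReal.ofReal ((U i₀ i) ^ 2) • Measure.dirac (l i ^ 2), ⟨?_⟩, ?_, hfin⟩
  · have := hpow 0
    simp only [pow_zero, Matrix.one_apply_eq, mul_one] at this
    simp only [Measure.coe_finsetSum, Finset.sum_apply, Measure.smul_apply, measure_univ,
      smul_eq_mul, mul_one]
    rw [← ENNReal.ofReal_sum_of_nonneg fun i _ => sq_nonneg _, ← this, ENNReal.ofReal_one]
  · simp only [Measure.coe_finsetSum, Finset.sum_apply, Measure.smul_apply, smul_eq_mul]
    refine Finset.sum_eq_zero fun i _ => ?_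
    rw [Measure.dirac_apply' _ measurableSet_Icc.compl, Set.indicator_of_notMem, mul_zero]
    simp only [Set.mem_compl_iff, not_not]
    exact ⟨sq_nonneg _, by simpa using hl i⟩

/-- The probability of an up step from height `n` in the random walk attached to `p`. -/
def upStep (p : ℕ → ℝ) : ℕ → ℝ
  | 0 => 1
  | n + 1 => 1 - p n

lemma zeta_eq_upStep (p : ℕ → ℝ) (n : ℕ) : zeta p n = upStep p n * p n := by
  cases n <;> simp [zeta, upStep]

/-- The truncated Jacobi matrix with zero diagonal and off-diagonal entries `√(zeta p i)`. -/
def jacobi (p : ℕ → ℝ) (N : ℕ) : Matrix (Fin (N + 1)) (Fin (N + 1)) ℝ :=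
  Matrix.of fun i j => (if (i : ℕ) + 1 = j then √(zeta p i) else 0) +
    if (j : ℕ) + 1 = i then √(zeta p j) else 0

lemma jacobi_isHermitian (p : ℕ → ℝ) (N : ℕ) : (jacobi p N).IsHermitian := by
  ext i j
  simp only [jacobi, Matrix.conjTranspose_apply, Matrix.of_apply, star_trivial]
  ring

lemma upStep_nonneg {p : ℕ → ℝ} (hp : ∀ i, p i ∈ Set.Icc (0 : ℝ) 1) (n : ℕ) :
    0 ≤ upStep p n := by
  cases n with
  | zero => simp [upStep]
  | succ n => simpa [upStep] using (hp n).2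

lemma zeta_nonneg {p : ℕ → ℝ} (hp : ∀ i, p i ∈ Set.Icc (0 : ℝ) 1) (n : ℕ) :
    0 ≤ zeta p n := by
  rw [zeta_eq_upStep]; exact mul_nonneg (upStep_nonneg hp n) (hp n).1

lemma jacobi_form_le {p : ℕ → ℝ} (hp : ∀ i, p i ∈ Set.Icc (0 : ℝ) 1) (N : ℕ)
    (v : Fin (N + 1) → ℝ) : |v ⬝ᵥ (jacobi p N).mulVec v| ≤ v ⬝ᵥ v := by
  have hsq : ∀ (n : ℕ) (x y : ℝ),
      |x * (√(zeta p n) * y)| ≤ (upStep p n * x ^ 2 + p n * y ^ 2) / 2 :=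
    fun n x y => by
      have h1 := Real.sq_sqrt (upStep_nonneg hp n)
      have h2 := Real.sq_sqrt (hp n).1
      rw [zeta_eq_upStep, Real.sqrt_mul (upStep_nonneg hp n), abs_le]
      constructor
      · nlinarith [sq_nonneg (√(upStep p n) * x + √(p n) * y)]
      · nlinarith [sq_nonneg (√(upStep p n) * x - √(p n) * y)]
  set B : Fin (N + 1) → Fin (N + 1) → ℝ := fun i j =>
    (if (i : ℕ) + 1 = j then upStep p i else 0) + if (j : ℕ) + 1 = i then p j else 0 with hB
  have hterm : ∀ i j, |v i * (jacobi p N i j * v j)| ≤ (B i j * v i ^ 2 + B j i * v j ^ 2) / 2 := by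
    intro i j
    simp only [jacobi, hB, Matrix.of_apply]
    by_cases h1 : (i : ℕ) + 1 = j
    · have h2 : ¬ (j : ℕ) + 1 = i := by omega
      simpa [h1, h2] using hsq i (v i) (v j)
    · by_cases h2 : (j : ℕ) + 1 = i
      · have := hsq j (v j) (v i)
        have e : v j * (√(zeta p j) * v i) = v i * (√(zeta p j) * v j) := by ring
        rw [e, add_comm (upStep p j * v j ^ 2)] at this
        simpa [h1, h2] using this
      · simp [h1, h2]
  have hrow : ∀ i, ∑ j, B i j ≤ 1 := fun i => by
    have hone : ∀ (m : ℕ) (c : ℝ), 0 ≤ c →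
        ∑ j : Fin (N + 1), (if m = (j : ℕ) then c else 0) ≤ c := fun m c hc => by
      rw [Fin.sum_univ_eq_sum_range (fun j => if m = j then c else 0), Finset.sum_ite_eq]
      split_ifs <;> simp [hc]
    simp only [hB, Finset.sum_add_distrib]
    have h1 := hone (i + 1) _ (upStep_nonneg hp i)
    rcases hi : (i : ℕ) with _ | n
    · rw [hi] at h1
      simpa [upStep] using h1
    · rw [hi] at h1
      have h2 := hone n _ (hp n).1
      have : ∀ j : Fin (N + 1), (if (j : ℕ) + 1 = n + 1 then p j else 0) =
          if n = (j : ℕ) then p n else 0 := fun j => by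
        by_cases h : n = (j : ℕ)
        · simp [h]
        · simp [h, Ne.symm h]
      simp only [this]
      simp only [upStep] at h1 ⊢
      linarith
  calc |v ⬝ᵥ (jacobi p N).mulVec v| = |∑ i, ∑ j, v i * (jacobi p N i j * v j)| := by
        simp only [dotProduct, Matrix.mulVec, Finset.mul_sum]
    _ ≤ ∑ i, ∑ j, |v i * (jacobi p N i j * v j)| :=
        (Finset.abs_sum_le_sum_abs _ _).trans
          (Finset.sum_le_sum fun i _ => Finset.abs_sum_le_sum_abs _ _)
    _ ≤ ∑ i, ∑ j, (B i j * v i ^ 2 + B j i * v j ^ 2) / 2 :=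
        Finset.sum_le_sum fun i _ => Finset.sum_le_sum fun j _ => hterm i j
    _ = ∑ i, (∑ j, B i j) * v i ^ 2 := by
        simp only [add_div, Finset.sum_add_distrib]
        rw [Finset.sum_comm (f := fun i j => B j i * v j ^ 2 / 2), ← Finset.sum_add_distrib]
        refine Finset.sum_congr rfl fun i _ => ?_
        rw [← Finset.sum_div, ← add_div, ← Finset.sum_mul]
        ring
    _ ≤ ∑ i, 1 * v i ^ 2 :=
        Finset.sum_le_sum fun i _ => mul_le_mul_of_nonneg_right (hrow i) (sq_nonneg _)
    _ = v ⬝ᵥ v := by simp [dotProduct, sq]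

lemma jacobi_pow_apply {p : ℕ → ℝ} (hp : ∀ i, p i ∈ Set.Icc (0 : ℝ) 1) (N : ℕ) :
    ∀ (k n : ℕ) (h : k + n ≤ N),
      (jacobi p N ^ k) 0 ⟨n, by omega⟩ * ∏ i ∈ Finset.range n, √(zeta p i) = dyck p k n := by
  intro k
  induction k with
  | zero =>
    intro n h
    cases n with
    | zero => simp [dyck]
    | succ n =>
      rw [pow_zero, Matrix.one_apply_ne (by simp [Fin.ext_iff])]
      simp [dyck]
  | succ k ih =>
    intro n h
    have hup : ∑ m : Fin (N + 1), (jacobi p N ^ k) 0 m *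
        (if n + 1 = (m : ℕ) then √(zeta p n) else 0) =
          (jacobi p N ^ k) 0 ⟨n + 1, by omega⟩ * √(zeta p n) := by
      rw [Finset.sum_eq_single ⟨n + 1, by omega⟩]
      · simp
      · intro m _ hm
        rw [if_neg, mul_zero]
        exact fun h => hm (Fin.ext h.symm)
      · simp
    have hup' := ih (n + 1) (by omega)
    rw [Finset.prod_range_succ] at hup'
    rw [pow_succ, Matrix.mul_apply]
    simp only [jacobi, Matrix.of_apply, mul_add, Finset.sum_add_distrib] at hup hup' ⊢
    rw [hup, add_mul]
    cases n with
    | zero =>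
      rw [dyck, ← hup']
      simp
    | succ n =>
      have hdown : ∑ m : Fin (N + 1), (jacobi p N ^ k) 0 m *
          (if (m : ℕ) + 1 = n + 1 then √(zeta p m) else 0) =
            (jacobi p N ^ k) 0 ⟨n, by omega⟩ * √(zeta p n) := by
        rw [Finset.sum_eq_single ⟨n, by omega⟩]
        · simp
        · intro m _ hm
          rw [if_neg, mul_zero]
          exact fun h => hm (Fin.ext (by simpa using h))
        · simp
      have hdown' := ih n (by omega)
      simp only [jacobi] at hdown hdown'
      rw [hdown, dyck, ← hup', ← hdown', Finset.prod_range_succ]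
      have := Real.mul_self_sqrt (zeta_nonneg hp n)
      linear_combination ((Matrix.of (fun (i j : Fin (N + 1)) =>
        (if (i : ℕ) + 1 = j then √(zeta p i) else 0) +
          if (j : ℕ) + 1 = i then √(zeta p j) else 0)) ^ k) 0 ⟨n, by omega⟩ *
            (∏ i ∈ Finset.range n, √(zeta p i)) * this

lemma exists_unit_measure {p : ℕ → ℝ} (hp : ∀ i, p i ∈ Set.Icc (0 : ℝ) 1) (N : ℕ) :
    ∃ μ : Measure ℝ, IsProbabilityMeasure μ ∧ μ (Set.Icc 0 1)ᶜ = 0 ∧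
      ∀ j ≤ N, ∫ x, x ^ j ∂μ = unitMoment p j := by
  obtain ⟨μ, h1, h2, h3⟩ := exists_unit_measure_of_isHermitian (jacobi_isHermitian p (2 * N))
    (jacobi_form_le hp (2 * N)) 0
  refine ⟨μ, h1, h2, fun j hj => ?_⟩
  rw [h3, unitMoment, ← jacobi_pow_apply hp (2 * N) (2 * j) 0 (by omega)]
  simp

/-! ### Moments of measures on compact intervals -/

lemma integrable_of_measure_compl_eq_zero {μ : Measure ℝ} [IsFiniteMeasure μ] {K : Set ℝ}
    (hK : IsCompact K) (hμ : μ Kᶜ = 0) {f : ℝ → ℝ} (hf : Continuous f) : Integrable f μ := by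
  have : μ.restrict K = μ := Measure.restrict_eq_self_of_ae_mem (by
    rw [ae_iff]; exact hμ)
  rw [← this]
  exact hf.continuousOn.integrableOn_compact hK

lemma momentFunctional_symMoment_eq_integral {μ : Measure ℝ} [IsProbabilityMeasure μ]
    (hμ : μ (Set.Icc 0 1)ᶜ = 0) (f : ℝ[X]) :
    momentFunctional (symMoment fun j => ∫ x, x ^ j ∂μ) f =
      ∫ x, (f.eval √x + f.eval (-√x)) / 2 ∂μ := by
  have hae : ∀ᵐ x ∂μ, x ∈ Set.Icc (0 : ℝ) 1 := by rw [ae_iff]; exact hμ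
  have hmom : ∀ k, symMoment (fun j => ∫ x, x ^ j ∂μ) k =
      ∫ x, (√x ^ k + (-√x) ^ k) / 2 ∂μ := fun k => by
    unfold symMoment
    split_ifs with h
    · obtain ⟨i, rfl⟩ := h
      refine integral_congr_ae ?_
      filter_upwards [hae] with x hx
      have : (i + i) / 2 = i := by omega
      rw [this, ← two_mul, pow_mul, pow_mul, neg_sq, Real.sq_sqrt hx.1]
      ring
    · rw [Nat.not_even_iff_odd] at h
      simp [h.neg_pow]
  rw [momentFunctional_eq_sum _ f le_rfl]
  simp only [hmom, ← integral_const_mul]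
  rw [← integral_finsetSum]
  · refine integral_congr_ae (Eventually.of_forall fun x => ?_)
    simp only [eval_eq_sum_range, ← Finset.sum_add_distrib, Finset.sum_div]
    exact Finset.sum_congr rfl fun i _ => by ring
  · intro i _
    exact integrable_of_measure_compl_eq_zero isCompact_Icc hμ (by fun_prop)

lemma momentFunctional_symMoment_nonneg {μ : Measure ℝ} [IsProbabilityMeasure μ]
    (hμ : μ (Set.Icc 0 1)ᶜ = 0) {f : ℝ[X]} (hf : ∀ x ∈ Set.Icc (-1 : ℝ) 1, 0 ≤ f.eval x) :
    0 ≤ momentFunctional (symMoment fun j => ∫ x, x ^ j ∂μ) f := by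
  have hae : ∀ᵐ x ∂μ, x ∈ Set.Icc (0 : ℝ) 1 := by rw [ae_iff]; exact hμ
  rw [momentFunctional_symMoment_eq_integral hμ]
  refine integral_nonneg_of_ae ?_
  filter_upwards [hae] with x hx
  have h1 : √x ≤ 1 := Real.sqrt_le_one.2 hx.2
  have h0 := Real.sqrt_nonneg x
  have := hf √x ⟨by linarith, h1⟩
  have := hf (-√x) ⟨by linarith, by linarith⟩
  simp only [Pi.zero_apply]
  linarith

/-- The moments of the image under `x ↦ (b - a) * x + a` of a measure with moments `c`. -/
def affineMoment (a b : ℝ) (c : ℕ → ℝ) (j : ℕ) : ℝ :=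
  ∑ i ∈ Finset.range (j + 1), (b - a) ^ i * a ^ (j - i) * (j.choose i) * c i

lemma affineMoment_congr {a b : ℝ} {c c' : ℕ → ℝ} {j : ℕ} (h : ∀ i ≤ j, c i = c' i) :
    affineMoment a b c j = affineMoment a b c' j :=
  Finset.sum_congr rfl fun i hi => by rw [h i (by rw [Finset.mem_range] at hi; omega)]

lemma affineMoment_succ_sub {a b : ℝ} {c c' : ℕ → ℝ} {j : ℕ} (h : ∀ i ≤ j, c i = c' i) :
    affineMoment a b c (j + 1) - affineMoment a b c' (j + 1) =
      (b - a) ^ (j + 1) * (c (j + 1) - c' (j + 1)) := by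
  rw [affineMoment, affineMoment, Finset.sum_range_succ, Finset.sum_range_succ _ (j + 1),
    Finset.sum_congr rfl fun i hi => by
      rw [h i (by rw [Finset.mem_range] at hi; omega)]]
  simp
  ring

lemma eq_of_affineMoment_eq {a b : ℝ} (hab : a < b) {c c' : ℕ → ℝ} {j : ℕ}
    (h : ∀ i ≤ j, affineMoment a b c i = affineMoment a b c' i) : ∀ i ≤ j, c i = c' i := by
  intro i
  induction i using Nat.strong_induction_on with
  | _ i ih =>
    intro hi
    cases i with
    | zero => simpa [affineMoment] using h 0 hi
    | succ i =>
      have h1 := affineMoment_succ_sub (a := a) (b := b) (c := c) (c' := c') (j := i)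
        fun m hm => ih m (by omega) (by omega)
      rw [h _ hi, sub_self, eq_comm, mul_eq_zero] at h1
      rcases h1 with h1 | h1
      · exact absurd h1 (pow_pos (sub_pos.2 hab) _).ne'
      · linarith

lemma integral_affine_pow {μ : Measure ℝ} [IsProbabilityMeasure μ] {K : Set ℝ}
    (hK : IsCompact K) (hμ : μ Kᶜ = 0) (a b : ℝ) (j : ℕ) :
    ∫ x, ((b - a) * x + a) ^ j ∂μ = affineMoment a b (fun i => ∫ x, x ^ i ∂μ) j := by
  simp only [add_pow, affineMoment, mul_pow]
  rw [integral_finsetSum]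
  · refine Finset.sum_congr rfl fun i _ => ?_
    rw [← integral_const_mul]
    congr 1; ext x; ring
  · intro i _
    exact integrable_of_measure_compl_eq_zero hK hμ (by fun_prop)

/-- The `j`-th moment on `[a,b]` with canonical moments `p`. -/
def canMoment (a b : ℝ) (p : ℕ → ℝ) (j : ℕ) : ℝ := affineMoment a b (unitMoment p) j

/-- The length of the range of the `(j+1)`-st moment on `[a,b]`. -/
def canRange (a b : ℝ) (p : ℕ → ℝ) (j : ℕ) : ℝ := (b - a) ^ (j + 1) * unitRange p j

lemma canMoment_zero (a b : ℝ) (p : ℕ → ℝ) : canMoment a b p 0 = 1 := by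
  simp [canMoment, affineMoment, unitMoment_zero]

lemma canMoment_congr {a b : ℝ} {p p' : ℕ → ℝ} {j : ℕ} (h : ∀ i < j, p i = p' i) :
    canMoment a b p j = canMoment a b p' j :=
  affineMoment_congr fun i hi => unitMoment_congr fun m hm => h m (by omega)

lemma canRange_congr {a b : ℝ} {p p' : ℕ → ℝ} {j : ℕ} (h : ∀ i < j, p i = p' i) :
    canRange a b p j = canRange a b p' j := by
  rw [canRange, canRange, unitRange_congr h]

lemma canMoment_succ_sub {a b : ℝ} {p p' : ℕ → ℝ} {j : ℕ} (h : ∀ i < j, p i = p' i) :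
    canMoment a b p (j + 1) - canMoment a b p' (j + 1) = canRange a b p j * (p j - p' j) := by
  rw [canMoment, canMoment, affineMoment_succ_sub fun i hi => unitMoment_congr fun m hm =>
    h m (by omega), unitMoment_succ_sub h, canRange, mul_assoc]

lemma canRange_pos {a b : ℝ} (hab : a < b) {p : ℕ → ℝ} {j : ℕ}
    (hp : ∀ i < j, p i ∈ Set.Ioo (0 : ℝ) 1) : 0 < canRange a b p j :=
  mul_pos (pow_pos (sub_pos.2 hab) _) (Finset.prod_pos fun i hi =>
    mul_pos (hp i (Finset.mem_range.1 hi)).1 (sub_pos.2 (hp i (Finset.mem_range.1 hi)).2))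

lemma exists_measure {a b : ℝ} (hab : a < b) {p : ℕ → ℝ} (hp : ∀ i, p i ∈ Set.Icc (0 : ℝ) 1)
    (N : ℕ) : ∃ μ : Measure ℝ, IsProbabilityMeasure μ ∧ μ (Set.Icc a b)ᶜ = 0 ∧
      ∀ j ≤ N, ∫ x, x ^ j ∂μ = canMoment a b p j := by
  obtain ⟨μ, hμ, h0, hm⟩ := exists_unit_measure hp N
  have hmeas : Measurable fun x : ℝ => (b - a) * x + a := by fun_prop
  refine ⟨μ.map fun x => (b - a) * x + a, Measure.isProbabilityMeasure_map hmeas.aemeasurable,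
    ?_, fun j hj => ?_⟩
  · rw [Measure.map_apply hmeas measurableSet_Icc.compl]
    refine measure_mono_null ?_ h0
    refine fun x hx hx' => hx ?_
    constructor <;> nlinarith [hx'.1, hx'.2]
  · rw [integral_map hmeas.aemeasurable (by fun_prop), integral_affine_pow isCompact_Icc h0]
    exact affineMoment_congr fun i hi => hm i (by omega)

lemma moment_succ_mem_Icc {a b : ℝ} (hab : a < b) {p : ℕ → ℝ} {j : ℕ} {μ : Measure ℝ}
    [IsProbabilityMeasure μ] (hμ : μ (Set.Icc a b)ᶜ = 0)
    (h : ∀ i ≤ j, ∫ x, x ^ i ∂μ = canMoment a b p i) :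
    canMoment a b p (j + 1) - canRange a b p j * p j ≤ ∫ x, x ^ (j + 1) ∂μ ∧
      ∫ x, x ^ (j + 1) ∂μ ≤ canMoment a b p (j + 1) + canRange a b p j * (1 - p j) := by
  have hba := sub_pos.2 hab
  have hmeas : Measurable fun x : ℝ => (x - a) / (b - a) := by fun_prop
  set ν := μ.map fun x => (x - a) / (b - a) with hν
  have : IsProbabilityMeasure ν := Measure.isProbabilityMeasure_map hmeas.aemeasurable
  have hν0 : ν (Set.Icc 0 1)ᶜ = 0 := by
    rw [hν, Measure.map_apply hmeas measurableSet_Icc.compl]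
    refine measure_mono_null ?_ hμ
    refine fun x hx hx' => hx ?_
    constructor
    · exact div_nonneg (by linarith [hx'.1]) hba.le
    · rw [div_le_one hba]; linarith [hx'.2]
  have hmom : ∀ i, ∫ x, x ^ i ∂μ = affineMoment a b (fun i => ∫ x, x ^ i ∂ν) i := fun i => by
    rw [← integral_affine_pow isCompact_Icc hν0, hν,
      integral_map hmeas.aemeasurable (by fun_prop)]
    congr 1; ext x
    congr 1
    field_simp
    ring
  have heq := eq_of_affineMoment_eq hab (c := fun i => ∫ x, x ^ i ∂ν) (c' := unitMoment p) (j := j)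
    fun i hi => by rw [← hmom, h i hi, canMoment]
  obtain ⟨h1, h2⟩ := next_moment_bounds heq fun f hf => momentFunctional_symMoment_nonneg hν0 hf
  have hsub := affineMoment_succ_sub (a := a) (b := b) heq
  rw [← hmom, ← canMoment] at hsub
  have hpos := pow_pos hba (j + 1)
  have e1 := mul_le_mul_of_nonneg_left h1 hpos.le
  have e2 := mul_le_mul_of_nonneg_left h2 hpos.le
  rw [canRange]
  constructor <;> linarith

/-! ### Canonical moments as coordinates -/

/-- Extend a finite vector by zero. -/
def extend {n : ℕ} (u : Fin n → ℝ) (i : ℕ) : ℝ := if h : i < n then u ⟨i, h⟩ else 0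

lemma extend_apply {n : ℕ} (u : Fin n → ℝ) (i : Fin n) : extend u i = u i := by
  simp [extend]

/-- The vector of the first `n` moments as a function of the canonical moments. -/
def momentMap (a b : ℝ) (n : ℕ) (u : Fin n → ℝ) (j : Fin n) : ℝ :=
  canMoment a b (extend u) (j + 1)

/-- The open cube of canonical moments. -/
def openCube (n : ℕ) : Set (Fin n → ℝ) := Set.univ.pi fun _ => Set.Ioo 0 1

lemma extend_mem_Ioo {n : ℕ} {u : Fin n → ℝ} (hu : u ∈ openCube n) {i : ℕ} (hi : i < n) :
    extend u i ∈ Set.Ioo (0 : ℝ) 1 := by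
  simpa [extend, hi] using hu ⟨i, hi⟩ (Set.mem_univ _)

lemma extend_mem_Icc {n : ℕ} {u : Fin n → ℝ} (hu : u ∈ openCube n) (i : ℕ) :
    extend u i ∈ Set.Icc (0 : ℝ) 1 := by
  by_cases hi : i < n
  · exact Set.Ioo_subset_Icc_self (extend_mem_Ioo hu hi)
  · simp [extend, hi]

lemma update_mem_Icc {n : ℕ} {u : Fin n → ℝ} (hu : u ∈ openCube n) (j : ℕ) {t : ℝ}
    (ht : t ∈ Set.Icc (0 : ℝ) 1) (i : ℕ) :
    Function.update (extend u) j t i ∈ Set.Icc (0 : ℝ) 1 := by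
  rw [Function.update_apply]
  split_ifs
  · exact ht
  · exact extend_mem_Icc hu i

lemma mem_momentSection {a b : ℝ} (hab : a < b) {n : ℕ} {u : Fin n → ℝ} (hu : u ∈ openCube n)
    (j : Fin n) {t : ℝ} (ht : t ∈ Set.Icc (0 : ℝ) 1) :
    canMoment a b (extend u) (j + 1) + canRange a b (extend u) j * (t - u j) ∈
      momentSection a b (momentMap a b n u) (j + 1) := by
  obtain ⟨μ, h1, h2, h3⟩ := exists_measure hab (update_mem_Icc hu j ht) (j + 1)
  have hcongr : ∀ i < (j : ℕ), Function.update (extend u) j t i = extend u i := fun i hi =>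
    Function.update_of_ne hi.ne _ _
  refine ⟨μ, h1, h2, fun i hi => ?_, ?_⟩
  · rw [h3 _ (by omega), momentMap]
    exact canMoment_congr fun m hm => hcongr m (by omega)
  · have := canMoment_succ_sub (a := a) (b := b) hcongr
    rw [Function.update_self, extend_apply, canRange_congr hcongr] at this
    rw [h3 _ le_rfl]
    linarith

lemma momentSection_subset {a b : ℝ} (hab : a < b) {n : ℕ} {u : Fin n → ℝ}
    (j : Fin n) {m : ℝ} (hm : m ∈ momentSection a b (momentMap a b n u) (j + 1)) :
    canMoment a b (extend u) (j + 1) + canRange a b (extend u) j * (0 - u j) ≤ m ∧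
      m ≤ canMoment a b (extend u) (j + 1) + canRange a b (extend u) j * (1 - u j) := by
  obtain ⟨μ, h1, h2, h3, rfl⟩ := hm
  have := moment_succ_mem_Icc hab (p := extend u) (j := j) h2 fun i hi => by
    cases i with
    | zero => simp [canMoment_zero]
    | succ i =>
      have := h3 ⟨i, by omega⟩ (by simpa using hi)
      simpa [momentMap] using this
  rw [extend_apply] at this
  constructor <;> linarith

lemma canCompact_momentMap {a b : ℝ} (hab : a < b) {n : ℕ} {u : Fin n → ℝ} (hu : u ∈ openCube n)
    (j : Fin n) : canCompact a b (momentMap a b n u) j = u j := by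
  have hL : IsLeast (momentSection a b (momentMap a b n u) (j + 1))
      (canMoment a b (extend u) (j + 1) + canRange a b (extend u) j * (0 - u j)) :=
    ⟨mem_momentSection hab hu j (by simp), fun m hm => (momentSection_subset hab j hm).1⟩
  have hG : IsGreatest (momentSection a b (momentMap a b n u) (j + 1))
      (canMoment a b (extend u) (j + 1) + canRange a b (extend u) j * (1 - u j)) :=
    ⟨mem_momentSection hab hu j (by simp), fun m hm => (momentSection_subset hab j hm).2⟩
  have hpos : 0 < canRange a b (extend u) j :=
    canRange_pos hab fun i hi => extend_mem_Ioo hu (by omega)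
  rw [canCompact, hL.csInf_eq, hG.csSup_eq, momentMap, div_eq_iff (by linarith)]
  ring

lemma momentMap_injOn {a b : ℝ} (hab : a < b) (n : ℕ) :
    Set.InjOn (momentMap a b n) (openCube n) := fun u hu u' hu' h => by
  ext j
  rw [← canCompact_momentMap hab hu j, h, canCompact_momentMap hab hu' j]

lemma momentMap_mem_momentSpace {a b : ℝ} (hab : a < b) {n : ℕ} {u : Fin n → ℝ}
    (hu : u ∈ openCube n) : momentMap a b n u ∈ momentSpace (Set.Icc a b) n := by
  obtain ⟨μ, h1, h2, h3⟩ := exists_measure hab (extend_mem_Icc hu) n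
  exact ⟨μ, h1, h2, fun j => integrable_of_measure_compl_eq_zero isCompact_Icc h2 (by fun_prop),
    fun j => (h3 _ (by omega)).symm⟩

lemma interior_momentSpace_subset {a b : ℝ} (hab : a < b) (n : ℕ) :
    interior (momentSpace (Set.Icc a b) n) ⊆ momentMap a b n '' openCube n := by
  intro v hv
  have key : ∀ k ≤ n, ∃ p : ℕ → ℝ, (∀ i < k, p i ∈ Set.Ioo (0 : ℝ) 1) ∧
      ∀ i : Fin n, (i : ℕ) < k → v i = canMoment a b p (i + 1) := by
    intro k
    induction k with
    | zero => exact fun _ => ⟨0, by simp, by simp⟩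
    | succ k ih =>
      intro hk
      obtain ⟨p, hp, hpv⟩ := ih (by omega)
      have hR := canRange_pos hab hp
      set j : Fin n := ⟨k, hk⟩
      have hbound : ∀ w ∈ momentSpace (Set.Icc a b) n, (∀ i : Fin n, (i : ℕ) < k → w i = v i) →
          canMoment a b p (k + 1) - canRange a b p k * p k ≤ w j ∧
            w j ≤ canMoment a b p (k + 1) + canRange a b p k * (1 - p k) := by
        rintro w ⟨μ, h1, h2, -, h3⟩ hw
        rw [h3 j]
        refine moment_succ_mem_Icc hab h2 fun i hi => ?_
        cases i with
        | zero => simp [canMoment_zero]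
        | succ i =>
          have := hw ⟨i, by omega⟩ hi
          rw [h3, hpv ⟨i, by omega⟩ hi] at this
          exact this
      have hline : ∀ᶠ t : ℝ in 𝓝 0, Function.update v j (v j + t) ∈
          momentSpace (Set.Icc a b) n := by
        have hc : Tendsto (fun t : ℝ => Function.update v j (v j + t)) (𝓝 0) (𝓝 v) := by
          have : Continuous fun t : ℝ => Function.update v j (v j + t) :=
            continuous_const.update j (by fun_prop)
          simpa using this.tendsto 0
        exact hc.eventually (mem_interior_iff_mem_nhds.1 hv)
      obtain ⟨ε, hε, hball⟩ := Metric.eventually_nhds_iff.1 hline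
      have hb1 := (hbound _ (hball (y := -(ε / 2)) (by
        rw [dist_zero_right, norm_neg, Real.norm_of_nonneg (by positivity)]; linarith))
        fun i hi => Function.update_of_ne (by rintro rfl; simp [j] at hi) _ _).1
      have hb2 := (hbound _ (hball (y := ε / 2) (by
        rw [dist_zero_right, Real.norm_of_nonneg (by positivity)]; linarith))
        fun i hi => Function.update_of_ne (by rintro rfl; simp [j] at hi) _ _).2
      rw [Function.update_self] at hb1 hb2
      have hcongr : ∀ i < k, Function.update p k
          (p k + (v j - canMoment a b p (k + 1)) / canRange a b p k) i = p i := fun i hi =>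
        Function.update_of_ne hi.ne _ _
      refine ⟨Function.update p k (p k + (v j - canMoment a b p (k + 1)) / canRange a b p k),
        fun i hi => ?_, fun i hi => ?_⟩
      · rcases Nat.lt_succ_iff_lt_or_eq.1 hi with hi | rfl
        · rw [hcongr i hi]; exact hp i hi
        · rw [Function.update_self]
          constructor
          · have : -p i < (v j - canMoment a b p (i + 1)) / canRange a b p i := by
              rw [lt_div_iff₀ hR]; linarith
            linarith
          · have : (v j - canMoment a b p (i + 1)) / canRange a b p i < 1 - p i := by
              rw [div_lt_iff₀ hR]; linarith
            linarith
      · rcases Nat.lt_succ_iff_lt_or_eq.1 hi with hi | hi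
        · rw [hpv i hi]
          exact canMoment_congr fun m hm => (hcongr m (by omega)).symm
        · obtain rfl : i = j := Fin.ext hi
          have := canMoment_succ_sub (a := a) (b := b) hcongr
          rw [Function.update_self, canRange_congr hcongr, add_sub_cancel_left,
            mul_div_cancel₀ _ hR.ne'] at this
          change v j = canMoment a b _ (k + 1)
          linarith
  obtain ⟨p, hp, hpv⟩ := key n le_rfl
  refine ⟨fun i => p i, fun i _ => hp i i.2, ?_⟩
  ext i
  rw [hpv i i.2, momentMap]
  exact canMoment_congr fun m hm => by simp [extend, show m < n by omega]

/-! ### The Jacobian of the canonical coordinates -/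

lemma continuous_dyck (k n : ℕ) : Continuous fun p : ℕ → ℝ => dyck p k n := by
  have hz : ∀ n, Continuous fun p : ℕ → ℝ => zeta p n := fun n => by
    cases n <;> simp only [zeta] <;> fun_prop
  induction k generalizing n with
  | zero => cases n <;> simp only [dyck] <;> fun_prop
  | succ k ih =>
    cases n with
    | zero => simpa only [dyck] using ih 1
    | succ n =>
      simp only [dyck]
      exact (ih (n + 2)).add ((hz n).mul (ih n))

lemma continuous_canMoment (a b : ℝ) (j : ℕ) : Continuous fun p : ℕ → ℝ => canMoment a b p j := by
  unfold canMoment affineMoment unitMoment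
  exact continuous_finsetSum _ fun i _ => continuous_const.mul (continuous_dyck _ _)

lemma contDiff_extend {n : ℕ} (i : ℕ) : ContDiff ℝ 1 fun u : Fin n → ℝ => extend u i := by
  unfold extend
  split_ifs <;> fun_prop

lemma contDiff_dyck_extend {m : ℕ} (k n : ℕ) :
    ContDiff ℝ 1 fun u : Fin m → ℝ => dyck (extend u) k n := by
  have hz : ∀ n, ContDiff ℝ 1 fun u : Fin m → ℝ => zeta (extend u) n := fun n => by
    cases n with
    | zero => exact contDiff_extend 0
    | succ n => exact (contDiff_const.sub (contDiff_extend n)).mul (contDiff_extend (n + 1))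
  induction k generalizing n with
  | zero => cases n <;> simp only [dyck] <;> fun_prop
  | succ k ih =>
    cases n with
    | zero => simpa only [dyck] using ih 1
    | succ n =>
      simp only [dyck]
      exact (ih (n + 2)).add ((hz n).mul (ih n))

lemma contDiff_momentMap (a b : ℝ) (n : ℕ) : ContDiff ℝ 1 (momentMap a b n) := by
  rw [contDiff_pi]
  intro j
  unfold momentMap canMoment affineMoment unitMoment
  exact ContDiff.sum fun i _ => contDiff_const.mul (contDiff_dyck_extend _ _)

lemma det_fderiv_momentMap (a b : ℝ) (n : ℕ) (u : Fin n → ℝ) :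
    (fderiv ℝ (momentMap a b n) u).det = ∏ j : Fin n, canRange a b (extend u) j := by
  have hd : HasFDerivAt (momentMap a b n) (fderiv ℝ (momentMap a b n) u) u :=
    ((contDiff_momentMap a b n).differentiable (by norm_num) u).hasFDerivAt
  have hcoord : ∀ i j : Fin n, HasDerivAt (fun t : ℝ => momentMap a b n (u + t • Pi.single i 1) j)
      (fderiv ℝ (momentMap a b n) u (Pi.single i 1) j) 0 := fun i j => by
    have hl := (hd.hasLineDerivAt (Pi.single i 1))
    exact hasDerivAt_pi.1 hl j
  have hext : ∀ (i : Fin n) (t : ℝ) (m : ℕ), m < i →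
      extend (u + t • Pi.single i (1 : ℝ)) m = extend u m := fun i t m hm => by
    by_cases h : m < n
    · simp [extend, h, Fin.ext_iff, hm.ne]
    · simp [extend, h]
  have hzero : ∀ i j : Fin n, j < i → fderiv ℝ (momentMap a b n) u (Pi.single i 1) j = 0 :=
    fun i j hij => by
      refine (hcoord i j).unique ?_
      have : (fun t : ℝ => momentMap a b n (u + t • Pi.single i 1) j) =
          fun _ => momentMap a b n u j := by
        ext t
        exact canMoment_congr fun m hm => hext i t m (by have := Fin.lt_def.1 hij; omega)
      rw [this]
      exact hasDerivAt_const _ _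
  have hdiag : ∀ j : Fin n, fderiv ℝ (momentMap a b n) u (Pi.single j 1) j =
      canRange a b (extend u) j := fun j => by
    refine (hcoord j j).unique ?_
    have : (fun t : ℝ => momentMap a b n (u + t • Pi.single j 1) j) =
        fun t => momentMap a b n u j + canRange a b (extend u) j * t := by
      ext t
      have := canMoment_succ_sub (a := a) (b := b) (hext j t)
      rw [canRange_congr (hext j t), extend_apply, extend_apply] at this
      simp only [Pi.add_apply, Pi.smul_apply, Pi.single_eq_same, smul_eq_mul, mul_one,
        add_sub_cancel_left] at this
      simp only [momentMap]
      linarith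
    rw [this]
    simpa using ((hasDerivAt_id (0 : ℝ)).const_mul (canRange a b (extend u) j)).const_add
      (momentMap a b n u j)
  rw [ContinuousLinearMap.det, ← LinearMap.det_toMatrix',
    Matrix.det_of_isLowerTriangular _ (fun i j hij => ?_)]
  · refine Finset.prod_congr rfl fun j _ => ?_
    rw [LinearMap.toMatrix'_apply]
    simpa [Pi.single_apply, eq_comm] using hdiag j
  · rw [LinearMap.toMatrix'_apply]
    simpa [Pi.single_apply, eq_comm] using hzero j i (by simpa using hij)

lemma prod_range_prod_range (f : ℕ → ℝ) (n : ℕ) :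
    ∏ j ∈ Finset.range n, ∏ i ∈ Finset.range j, f i =
      ∏ i ∈ Finset.range n, f i ^ (n - 1 - i) := by
  induction n with
  | zero => simp
  | succ n ih =>
    rw [Finset.prod_range_succ, ih, Finset.prod_range_succ]
    simp only [Nat.add_sub_cancel, Nat.sub_self, pow_zero, mul_one]
    rw [← Finset.prod_mul_distrib]
    refine Finset.prod_congr rfl fun i hi => ?_
    rw [← pow_succ]
    congr 1
    have := Finset.mem_range.1 hi
    omega

lemma prod_canRange (a b : ℝ) (n : ℕ) (u : Fin n → ℝ) :
    ∏ j : Fin n, canRange a b (extend u) j =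
      (∏ j : Fin n, (b - a) ^ ((j : ℕ) + 1)) * ∏ i : Fin n, (u i * (1 - u i)) ^ (n - 1 - i) := by
  have h : ∏ i : Fin n, (u i * (1 - u i)) ^ (n - 1 - (i : ℕ)) =
      ∏ i : Fin n, (extend u i * (1 - extend u i)) ^ (n - 1 - (i : ℕ)) := by
    simp only [extend_apply]
  simp only [canRange, Finset.prod_mul_distrib, unitRange]
  rw [h, Fin.prod_univ_eq_prod_range (fun i => (extend u i * (1 - extend u i)) ^ (n - 1 - i)),
    ← prod_range_prod_range (fun i => extend u i * (1 - extend u i)),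
    ← Fin.prod_univ_eq_prod_range
      (fun j => ∏ i ∈ Finset.range j, extend u i * (1 - extend u i))]
  simp only [Finset.prod_mul_distrib]

lemma det_fderiv_momentMap_pos {a b : ℝ} (hab : a < b) {n : ℕ} {u : Fin n → ℝ}
    (hu : u ∈ openCube n) : 0 < (fderiv ℝ (momentMap a b n) u).det := by
  rw [det_fderiv_momentMap]
  exact Finset.prod_pos fun j _ => canRange_pos hab fun i hi => extend_mem_Ioo hu (by omega)

lemma isOpen_openCube (n : ℕ) : IsOpen (openCube n) :=
  isOpen_set_pi Set.finite_univ fun _ _ => isOpen_Ioo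

lemma momentMap_image_openCube {a b : ℝ} (hab : a < b) (n : ℕ) :
    momentMap a b n '' openCube n = interior (momentSpace (Set.Icc a b) n) := by
  refine subset_antisymm ?_ (interior_momentSpace_subset hab n)
  rintro _ ⟨u, hu, rfl⟩
  rw [mem_interior_iff_mem_nhds]
  have hs : HasStrictFDerivAt (momentMap a b n) (fderiv ℝ (momentMap a b n) u) u :=
    (contDiff_momentMap a b n).contDiffAt.hasStrictFDerivAt (by norm_num)
  have hdet := det_fderiv_momentMap_pos hab hu
  have hsurj : (fderiv ℝ (momentMap a b n) u).range = ⊤ := by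
    have := LinearMap.range_eq_top.2
      (LinearEquiv.ofIsUnitDet (f := (fderiv ℝ (momentMap a b n) u).toLinearMap)
        (v := Pi.basisFun ℝ (Fin n)) (v' := Pi.basisFun ℝ (Fin n)) (by
          rw [LinearMap.det_toMatrix]; exact hdet.ne'.isUnit)).surjective
    exact this
  rw [← hs.map_nhds_eq_of_surj hsurj]
  refine mem_map.2 (mem_of_superset ((isOpen_openCube n).mem_nhds hu) fun w hw => ?_)
  exact momentMap_mem_momentSpace hab hw

/-! ### The law of the canonical moments -/

/-- The potential acting on the canonical moment with (zero-based) index `i`. -/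
def potential (V1 V2 : ℝ → ℝ) (i : ℕ) : ℝ → ℝ := if i % 2 = 0 then V1 else V2

/-- The unnormalized density of the canonical moment with (zero-based) index `i`. -/
def weight (V : ℝ → ℝ) (n i : ℕ) (t : ℝ) : ℝ :=
  Real.exp (-(n : ℝ) * V t) * (t * (1 - t)) ^ (n - 1 - i)

lemma continuousOn_weight {V : ℝ → ℝ} (hV : ContinuousOn V (Set.Icc 0 1)) (n i : ℕ) :
    ContinuousOn (weight V n i) (Set.Icc 0 1) := by
  unfold weight
  fun_prop

lemma weight_nonneg (V : ℝ → ℝ) (n i : ℕ) {t : ℝ} (ht : t ∈ Set.Icc (0 : ℝ) 1) :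
    0 ≤ weight V n i t :=
  mul_nonneg (Real.exp_pos _).le (pow_nonneg (mul_nonneg ht.1 (sub_nonneg.2 ht.2)) _)

lemma canDensityC_momentMap {a b : ℝ} (hab : a < b) (V1 V2 : ℝ → ℝ) {n : ℕ} {u : Fin n → ℝ}
    (hu : u ∈ openCube n) :
    canDensityC a b V1 V2 (momentMap a b n u) =
      ∏ j : Fin n, Real.exp (-(n : ℝ) * potential V1 V2 j (u j)) := by
  rw [canDensityC, Finset.mul_sum, Real.exp_sum]
  refine Finset.prod_congr rfl fun j _ => ?_
  rw [canCompact_momentMap hab hu, potential]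
  split_ifs <;> rfl

lemma measurableSet_momentMap_image {a b : ℝ} (hab : a < b) {n : ℕ} {T : Set (Fin n → ℝ)}
    (hT : MeasurableSet T) (hTc : T ⊆ openCube n) : MeasurableSet (momentMap a b n '' T) :=
  measurable_image_of_fderivWithin hT
    (fun u _ => (((contDiff_momentMap a b n).differentiable (by norm_num) u).hasFDerivAt
      ).hasFDerivWithinAt) ((momentMap_injOn hab n).mono hTc)

lemma measure_momentMap_image {a b : ℝ} (hab : a < b) {V1 V2 : ℝ → ℝ}
    (hV1 : ContinuousOn V1 (Set.Icc 0 1)) (hV2 : ContinuousOn V2 (Set.Icc 0 1)) {n : ℕ}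
    {Q : Measure (Fin n → ℝ)} {Z : ℝ}
    (hQ : Q = (ENNReal.ofReal Z)⁻¹ •
      ((volume.restrict (interior (momentSpace (Set.Icc a b) n))).withDensity
        (fun v => ENNReal.ofReal (canDensityC a b V1 V2 v))))
    {s : Fin n → Set ℝ} (hs : ∀ i, MeasurableSet (s i)) (hsub : ∀ i, s i ⊆ Set.Ioo 0 1) :
    Q (momentMap a b n '' Set.univ.pi s) = (ENNReal.ofReal Z)⁻¹ * ENNReal.ofReal
      ((∏ j : Fin n, (b - a) ^ ((j : ℕ) + 1)) *
        ∏ i : Fin n, ∫ t in s i, weight (potential V1 V2 i) n i t) := by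
  have hT : MeasurableSet (Set.univ.pi s) := MeasurableSet.univ_pi hs
  have hTc : Set.univ.pi s ⊆ openCube n := Set.pi_mono fun i _ => hsub i
  have himg := measurableSet_momentMap_image hab hT hTc
  have hInt : momentMap a b n '' Set.univ.pi s ⊆ interior (momentSpace (Set.Icc a b) n) := by
    rw [← momentMap_image_openCube hab]
    exact Set.image_mono hTc
  have hcont : ∀ i : Fin n, ContinuousOn (weight (potential V1 V2 i) n i) (Set.Icc 0 1) :=
    fun i => continuousOn_weight (by unfold potential; split_ifs <;> assumption) n i
  have hintw : ∀ i : Fin n, Integrable (weight (potential V1 V2 i) n i)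
      (volume.restrict (s i)) := fun i =>
    ((hcont i).integrableOn_compact isCompact_Icc).mono_set
      ((hsub i).trans Set.Ioo_subset_Icc_self)
  have hba : 0 ≤ ∏ j : Fin n, (b - a) ^ ((j : ℕ) + 1) :=
    Finset.prod_nonneg fun j _ => pow_nonneg (sub_pos.2 hab).le _
  rw [hQ, Measure.smul_apply, smul_eq_mul, withDensity_apply _ himg,
    Measure.restrict_restrict himg, Set.inter_eq_left.2 hInt,
    lintegral_image_eq_lintegral_abs_det_fderiv_mul volume hT
      (fun u _ => (((contDiff_momentMap a b n).differentiable (by norm_num) u).hasFDerivAt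
        ).hasFDerivWithinAt) ((momentMap_injOn hab n).mono hTc)]
  have hcongr : ∫⁻ u in Set.univ.pi s, ENNReal.ofReal |(fderiv ℝ (momentMap a b n) u).det| *
      ENNReal.ofReal (canDensityC a b V1 V2 (momentMap a b n u)) =
      ∫⁻ u in Set.univ.pi s, ENNReal.ofReal ((∏ j : Fin n, (b - a) ^ ((j : ℕ) + 1)) *
        ∏ i : Fin n, weight (potential V1 V2 i) n i (u i)) := by
    refine setLIntegral_congr_fun hT fun u hu => ?_
    have hu' := hTc hu
    rw [abs_of_pos (det_fderiv_momentMap_pos hab hu'), det_fderiv_momentMap, prod_canRange,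
      canDensityC_momentMap hab V1 V2 hu', ← ENNReal.ofReal_mul (mul_nonneg hba
        (Finset.prod_nonneg fun i _ => pow_nonneg (mul_nonneg (hu' i trivial).1.le
          (sub_nonneg.2 (hu' i trivial).2.le)) _)), mul_assoc, ← Finset.prod_mul_distrib]
    simp only [weight, mul_comm]
  rw [hcongr, ← ofReal_integral_eq_lintegral_ofReal]
  · rw [integral_const_mul, volume_pi, Measure.restrict_pi_pi,
      integral_fintype_prod_eq_prod (fun i : Fin n => weight (potential V1 V2 i) n i)]
  · refine Integrable.const_mul ?_ _
    rw [volume_pi, Measure.restrict_pi_pi]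
    exact Integrable.fintype_prod (f := fun i : Fin n => weight (potential V1 V2 i) n i) hintw
  · refine (ae_restrict_iff' hT).2 (Eventually.of_forall fun u hu => mul_nonneg hba ?_)
    exact Finset.prod_nonneg fun i _ => weight_nonneg _ _ _
      (Set.Ioo_subset_Icc_self (hTc hu i trivial))

lemma measure_canonical_le {a b : ℝ} (hab : a < b) {V1 V2 : ℝ → ℝ}
    (hV1 : ContinuousOn V1 (Set.Icc 0 1)) (hV2 : ContinuousOn V2 (Set.Icc 0 1)) {n : ℕ}
    {Q : Measure (Fin n → ℝ)} (hQ : isCompactDist a b V1 V2 n Q) (j : Fin n) {S : Set ℝ}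
    (hS : MeasurableSet S) {ρ : ℝ} (hρ : 0 ≤ ρ)
    (h : ∫ t in Set.Ioo 0 1 ∩ S, weight (potential V1 V2 j) n j t ≤
      ρ * ∫ t in Set.Ioo 0 1, weight (potential V1 V2 j) n j t) :
    Q (momentMap a b n '' (openCube n ∩ {u | u j ∈ S})) ≤ ENNReal.ofReal ρ := by
  obtain ⟨hprob, Z, -, hQ⟩ := hQ
  have hset : openCube n ∩ {u | u j ∈ S} =
      Set.univ.pi (Function.update (fun _ => Set.Ioo (0 : ℝ) 1) j (Set.Ioo 0 1 ∩ S)) := by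
    ext u
    simp only [openCube, Set.mem_inter_iff, Set.mem_univ_pi, Set.mem_ofPred_eq,
      Function.update_apply]
    refine ⟨fun hu i => ?_, fun hu => ⟨fun i => ?_, ?_⟩⟩
    · split_ifs with hi
      · exact ⟨hu.1 i, hi ▸ hu.2⟩
      · exact hu.1 i
    · have := hu i
      split_ifs at this
      · exact this.1
      · exact this
    · have := hu j
      rw [if_pos rfl] at this
      exact this.2
  have htot := measure_momentMap_image hab hV1 hV2 hQ (s := fun _ => Set.Ioo 0 1)
    (fun _ => measurableSet_Ioo) (fun _ => subset_rfl)
  have hnonneg : ∀ (i : Fin n) (s : Set ℝ), MeasurableSet s → s ⊆ Set.Ioo 0 1 →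
      0 ≤ ∫ t in s, weight (potential V1 V2 i) n i t := fun i s hs hsub =>
    setIntegral_nonneg hs fun t ht => weight_nonneg _ _ _ (Set.Ioo_subset_Icc_self (hsub ht))
  rw [hset, measure_momentMap_image hab hV1 hV2 hQ]
  · calc _ ≤ (ENNReal.ofReal Z)⁻¹ * ENNReal.ofReal (ρ * ((∏ j : Fin n, (b - a) ^ ((j : ℕ) + 1)) *
        ∏ i : Fin n, ∫ t in Set.Ioo 0 1, weight (potential V1 V2 i) n i t)) := by
          gcongr (ENNReal.ofReal Z)⁻¹ * ENNReal.ofReal ?_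
          rw [mul_left_comm]
          refine mul_le_mul_of_nonneg_left ?_
            (Finset.prod_nonneg fun j _ => pow_nonneg (sub_pos.2 hab).le _)
          rw [← Finset.mul_prod_erase _ _ (Finset.mem_univ j),
            ← Finset.mul_prod_erase _ (fun i : Fin n => ∫ t in Set.Ioo 0 1, _)
              (Finset.mem_univ j), Function.update_self, ← mul_assoc]
          rw [Finset.prod_congr rfl fun i hi => by
            rw [Function.update_of_ne (Finset.ne_of_mem_erase hi)]]
          exact mul_le_mul_of_nonneg_right h (Finset.prod_nonneg fun i _ =>
            hnonneg i _ measurableSet_Ioo subset_rfl)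
      _ = ENNReal.ofReal ρ * Q (momentMap a b n '' Set.univ.pi fun _ => Set.Ioo 0 1) := by
          rw [htot, ENNReal.ofReal_mul hρ]
          ring
      _ ≤ ENNReal.ofReal ρ * 1 := by gcongr; exact prob_le_one
      _ = _ := mul_one _
  · intro i
    rw [Function.update_apply]
    split_ifs
    · exact measurableSet_Ioo.inter hS
    · exact measurableSet_Ioo
  · intro i
    rw [Function.update_apply]
    split_ifs
    · exact Set.inter_subset_left
    · exact subset_rfl

lemma measure_compl_momentMap_image {a b : ℝ} (hab : a < b) {V1 V2 : ℝ → ℝ} {n : ℕ}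
    {Q : Measure (Fin n → ℝ)} (hQ : isCompactDist a b V1 V2 n Q) :
    Q (momentMap a b n '' openCube n)ᶜ = 0 := by
  obtain ⟨-, Z, -, rfl⟩ := hQ
  have hm : MeasurableSet (interior (momentSpace (Set.Icc a b) n)) :=
    isOpen_interior.measurableSet
  rw [momentMap_image_openCube hab, Measure.smul_apply, withDensity_apply _ hm.compl,
    Measure.restrict_restrict hm.compl, Set.compl_inter_self]
  simp

/-! ### Exponential concentration of a single canonical moment -/

lemma exp_neg_mul_lt_of_minimizer {V : ℝ → ℝ} {q : ℝ} (hq : q ∈ Set.Ioo (0 : ℝ) 1)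
    (hmin : ∀ p ∈ Set.Ioo (0 : ℝ) 1, p ≠ q →
      V q - Real.log (q * (1 - q)) < V p - Real.log (p * (1 - p)))
    {t : ℝ} (ht : t ∈ Set.Icc (0 : ℝ) 1) (htq : t ≠ q) :
    Real.exp (-V t) * (t * (1 - t)) < Real.exp (-V q) * (q * (1 - q)) := by
  have key : ∀ s ∈ Set.Ioo (0 : ℝ) 1, Real.exp (-V s) * (s * (1 - s)) =
      Real.exp (-(V s - Real.log (s * (1 - s)))) := fun s hs => by
    rw [neg_sub, sub_eq_add_neg (Real.log _), add_comm (Real.log _), Real.exp_add,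
      Real.exp_log (mul_pos hs.1 (sub_pos.2 hs.2))]
  rw [key q hq]
  by_cases h : t ∈ Set.Ioo (0 : ℝ) 1
  · rw [key t h, Real.exp_lt_exp]
    linarith [hmin t h htq]
  · have : t * (1 - t) = 0 := by
      rcases ht.1.eq_or_lt with h0 | h0
      · simp [← h0]
      · rcases ht.2.eq_or_lt with h1 | h1
        · simp [h1]
        · exact absurd ⟨h0, h1⟩ h
    rw [this, mul_zero]
    exact Real.exp_pos _

lemma exists_weight_concentration {V : ℝ → ℝ} (hV : ContinuousOn V (Set.Icc 0 1)) {q : ℝ}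
    (hq : q ∈ Set.Ioo (0 : ℝ) 1)
    (hmin : ∀ p ∈ Set.Ioo (0 : ℝ) 1, p ≠ q →
      V q - Real.log (q * (1 - q)) < V p - Real.log (p * (1 - p)))
    (j : ℕ) {ε : ℝ} (hε : 0 < ε) :
    ∃ C r : ℝ, 0 ≤ C ∧ 0 ≤ r ∧ r < 1 ∧ ∀ m : ℕ,
      ∫ t in Set.Ioo 0 1 ∩ {t | ε ≤ |t - q|}, weight V (m + j + 1) j t ≤
        C * r ^ m * ∫ t in Set.Ioo 0 1, weight V (m + j + 1) j t := by
  set g : ℝ → ℝ := fun t => Real.exp (-V t) * (t * (1 - t)) with hg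
  have hgc : ContinuousOn g (Set.Icc 0 1) := by
    simp only [hg]
    fun_prop
  have hg0 : ∀ t ∈ Set.Icc (0 : ℝ) 1, 0 ≤ g t := fun t ht =>
    mul_nonneg (Real.exp_pos _).le (mul_nonneg ht.1 (sub_nonneg.2 ht.2))
  have hgq : ∀ t ∈ Set.Icc (0 : ℝ) 1, t ≠ q → g t < g q := fun t ht htq =>
    exp_neg_mul_lt_of_minimizer hq hmin ht htq
  have hgqpos : 0 < g q :=
    mul_pos (Real.exp_pos _) (mul_pos hq.1 (sub_pos.2 hq.2))
  have hw : ∀ m t, weight V (m + j + 1) j t = g t ^ m * Real.exp (-(j + 1 : ℝ) * V t) := by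
    intro m t
    have h1 : m + j + 1 - 1 - j = m := by omega
    simp only [hg]
    rw [weight, h1, mul_pow (Real.exp _), ← Real.exp_nat_mul, mul_right_comm, ← Real.exp_add]
    congr 2
    push_cast
    ring
  obtain ⟨s₁, hs₁, hs₁q, hfar⟩ : ∃ s₁, 0 ≤ s₁ ∧ s₁ < g q ∧
      ∀ t ∈ Set.Icc (0 : ℝ) 1 ∩ {t | ε ≤ |t - q|}, g t ≤ s₁ := by
    have hK : IsCompact (Set.Icc (0 : ℝ) 1 ∩ {t | ε ≤ |t - q|}) :=
      isCompact_Icc.inter_right (isClosed_le (by fun_prop) (by fun_prop))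
    rcases (Set.Icc (0 : ℝ) 1 ∩ {t | ε ≤ |t - q|}).eq_empty_or_nonempty with h | h
    · exact ⟨0, le_rfl, hgqpos, by simp [h]⟩
    · obtain ⟨t, ht, hmax⟩ := hK.exists_isMaxOn h (hgc.mono Set.inter_subset_left)
      refine ⟨g t, hg0 t ht.1, hgq t ht.1 ?_, fun s hs => hmax hs⟩
      rintro rfl
      have := ht.2
      simp only [Set.mem_ofPred_eq, sub_self, abs_zero] at this
      linarith
  obtain ⟨s₂, hs₁₂, hs₂q⟩ := exists_between hs₁q
  have hs₂ : 0 < s₂ := hs₁.trans_lt hs₁₂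
  obtain ⟨δ, hδ, hnear⟩ : ∃ δ > 0, ∀ t ∈ Set.Ioo (q - δ) (q + δ), t ∈ Set.Ioo (0 : ℝ) 1 ∧
      s₂ ≤ g t := by
    have hcont : ContinuousAt g q := hgc.continuousAt (Icc_mem_nhds hq.1 hq.2)
    obtain ⟨δ, hδ, h⟩ := Metric.eventually_nhds_iff_ball.1
      ((isOpen_Ioo.eventually_mem hq).and (hcont.eventually (lt_mem_nhds hs₂q)))
    rw [Real.ball_eq_Ioo] at h
    exact ⟨δ, hδ, fun t ht => ⟨(h t ht).1, (h t ht).2.le⟩⟩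
  obtain ⟨M, hM⟩ := isCompact_Icc.exists_bound_of_continuousOn hV
  have hlo : ∀ t ∈ Set.Icc (0 : ℝ) 1,
      Real.exp (-((j + 1 : ℝ) * M)) ≤ Real.exp (-(j + 1 : ℝ) * V t) := fun t ht => by
    rw [Real.exp_le_exp]
    have := (abs_le.1 (hM t ht)).2
    nlinarith [(Nat.cast_nonneg j : (0 : ℝ) ≤ j)]
  have hhi : ∀ t ∈ Set.Icc (0 : ℝ) 1,
      Real.exp (-(j + 1 : ℝ) * V t) ≤ Real.exp ((j + 1 : ℝ) * M) := fun t ht => by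
    rw [Real.exp_le_exp]
    have := (abs_le.1 (hM t ht)).1
    nlinarith [(Nat.cast_nonneg j : (0 : ℝ) ≤ j)]
  set lo := Real.exp (-((j + 1 : ℝ) * M))
  set hi := Real.exp ((j + 1 : ℝ) * M)
  have hlo0 : 0 < lo := Real.exp_pos _
  have hhi0 : 0 < hi := Real.exp_pos _
  refine ⟨hi / (lo * (2 * δ)), s₁ / s₂, by positivity, by positivity, (div_lt_one hs₂).2 hs₁₂,
    fun m => ?_⟩
  have hupper : ∫ t in Set.Ioo 0 1 ∩ {t | ε ≤ |t - q|}, weight V (m + j + 1) j t ≤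
      s₁ ^ m * hi := by
    have hvol : volume (Set.Ioo 0 1 ∩ {t : ℝ | ε ≤ |t - q|}) ≤ 1 :=
      (measure_mono Set.inter_subset_left).trans (by simp)
    have := norm_setIntegral_le_of_norm_le_const (μ := volume)
      (f := weight V (m + j + 1) j) (C := s₁ ^ m * hi)
      (s := Set.Ioo 0 1 ∩ {t : ℝ | ε ≤ |t - q|}) (hvol.trans_lt ENNReal.one_lt_top)
      fun t ht => by
        have ht' := Set.Ioo_subset_Icc_self ht.1
        rw [Real.norm_of_nonneg (weight_nonneg _ _ _ ht'), hw]
        exact mul_le_mul (pow_le_pow_left₀ (hg0 t ht') (hfar t ⟨ht', ht.2⟩) m) (hhi t ht')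
          (Real.exp_pos _).le (by positivity)
    refine (le_abs_self _).trans (this.trans (mul_le_of_le_one_right (by positivity) ?_))
    exact ENNReal.toReal_mono ENNReal.one_ne_top hvol
  have hintg : IntegrableOn (weight V (m + j + 1) j) (Set.Ioo 0 1) :=
    ((continuousOn_weight hV _ _).integrableOn_compact isCompact_Icc).mono_set
      Set.Ioo_subset_Icc_self
  have hsub : Set.Ioo (q - δ) (q + δ) ⊆ Set.Ioo 0 1 := fun t ht => (hnear t ht).1
  have hlower : s₂ ^ m * lo * (2 * δ) ≤ ∫ t in Set.Ioo 0 1, weight V (m + j + 1) j t := by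
    have h1 := setIntegral_ge_of_const_le_real (μ := volume) (c := s₂ ^ m * lo)
      measurableSet_Ioo (by simp) (fun t ht => by
        rw [hw]
        exact mul_le_mul (pow_le_pow_left₀ hs₂.le (hnear t ht).2 m)
          (hlo t (Set.Ioo_subset_Icc_self (hnear t ht).1)) hlo0.le
          (pow_nonneg (hg0 t (Set.Ioo_subset_Icc_self (hnear t ht).1)) _))
      (hintg.mono_set hsub)
    rw [Real.volume_real_Ioo_of_le (by linarith)] at h1
    refine le_trans (le_of_eq (by ring)) (h1.trans (setIntegral_mono_set hintg ?_
      hsub.eventuallyLE))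
    exact (ae_restrict_iff' measurableSet_Ioo).2 (Eventually.of_forall fun t ht =>
      weight_nonneg _ _ _ (Set.Ioo_subset_Icc_self ht))
  calc _ ≤ s₁ ^ m * hi := hupper
    _ = hi / (lo * (2 * δ)) * (s₁ / s₂) ^ m * (s₂ ^ m * lo * (2 * δ)) := by
        rw [div_pow]
        field_simp
    _ ≤ _ := by gcongr

/-! ### Almost sure and mean convergence -/

/-- The limiting canonical moments, alternating between the two minimizers. -/
def alternating (p1 p2 : ℝ) (i : ℕ) : ℝ := if i % 2 = 0 then p1 else p2

lemma ae_eventually_abs_extend_sub_lt {a b : ℝ} (hab : a < b) {V1 V2 : ℝ → ℝ}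
    (hV1 : ContinuousOn V1 (Set.Icc 0 1)) (hV2 : ContinuousOn V2 (Set.Icc 0 1)) {j : ℕ} {q : ℝ}
    (hq : q ∈ Set.Ioo (0 : ℝ) 1)
    (hmin : ∀ p ∈ Set.Ioo (0 : ℝ) 1, p ≠ q →
      potential V1 V2 j q - Real.log (q * (1 - q)) <
        potential V1 V2 j p - Real.log (p * (1 - p)))
    {Ω : Type*} [MeasurableSpace Ω] {P : Measure Ω} {X : (n : ℕ) → Ω → (Fin n → ℝ)}
    (hX : ∀ n, Measurable (X n))
    (hlaw : ∀ n : ℕ, 1 ≤ n → isCompactDist a b V1 V2 n (P.map (X n))) {ε : ℝ} (hε : 0 < ε) :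
    ∀ᵐ ω ∂P, ∀ᶠ n in atTop, ∀ u ∈ openCube n, momentMap a b n u = X n ω →
      |extend u j - q| < ε := by
  have hV : ContinuousOn (potential V1 V2 j) (Set.Icc 0 1) := by
    unfold potential
    split_ifs <;> assumption
  obtain ⟨C, r, hC, hr, hr1, hle⟩ := exists_weight_concentration hV hq hmin j hε
  have hmeas : MeasurableSet {t : ℝ | ε ≤ |t - q|} :=
    measurableSet_le (by fun_prop) (by fun_prop)
  set bad : (m : ℕ) → Set (Fin (m + j + 1) → ℝ) := fun m => momentMap a b (m + j + 1) ''
    (openCube (m + j + 1) ∩ {u | u ⟨j, by omega⟩ ∈ {t : ℝ | ε ≤ |t - q|}})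
  have hP : ∀ m, P (X (m + j + 1) ⁻¹' bad m) ≤ ENNReal.ofReal (C * r ^ m) := fun m =>
    (Measure.le_map_apply (hX _).aemeasurable _).trans
      (measure_canonical_le hab hV1 hV2 (hlaw _ (by omega)) ⟨j, by omega⟩ hmeas (by positivity)
        (hle m))
  have hsum : ∑' m, P (X (m + j + 1) ⁻¹' bad m) ≠ ⊤ :=
    ne_top_of_le_ne_top
      ((summable_geometric_of_lt_one hr hr1).mul_left C).tsum_ofReal_ne_top
      (ENNReal.tsum_le_tsum hP)
  filter_upwards [ae_eventually_notMem hsum] with ω hω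
  rw [← map_add_atTop_eq_nat (j + 1), eventually_map]
  filter_upwards [hω] with m hm u hu hux
  by_contra! h
  refine hm ⟨u, ⟨hu, ?_⟩, hux⟩
  simpa [extend, show j < m + (j + 1) by omega] using h

lemma ae_mem_image_openCube {a b : ℝ} (hab : a < b) {V1 V2 : ℝ → ℝ} {n : ℕ}
    {Ω : Type*} [MeasurableSpace Ω] {P : Measure Ω} {Y : Ω → (Fin n → ℝ)} (hY : Measurable Y)
    (hlaw : isCompactDist a b V1 V2 n (P.map Y)) :
    ∀ᵐ ω ∂P, ∃ u ∈ openCube n, momentMap a b n u = Y ω := by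
  have h := measure_compl_momentMap_image hab hlaw
  rw [Measure.map_apply hY
    (measurableSet_momentMap_image hab (isOpen_openCube n).measurableSet subset_rfl).compl] at h
  rw [ae_iff]
  exact h

lemma ae_tendsto_canMoment {a b : ℝ} (hab : a < b) {V1 V2 : ℝ → ℝ}
    (hV1 : ContinuousOn V1 (Set.Icc 0 1)) (hV2 : ContinuousOn V2 (Set.Icc 0 1)) {q : ℕ → ℝ}
    (hq : ∀ i, q i ∈ Set.Ioo (0 : ℝ) 1)
    (hmin : ∀ i, ∀ p ∈ Set.Ioo (0 : ℝ) 1, p ≠ q i →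
      potential V1 V2 i (q i) - Real.log (q i * (1 - q i)) <
        potential V1 V2 i p - Real.log (p * (1 - p)))
    {Ω : Type*} [MeasurableSpace Ω] {P : Measure Ω} {X : (n : ℕ) → Ω → (Fin n → ℝ)}
    (hX : ∀ n, Measurable (X n))
    (hlaw : ∀ n : ℕ, 1 ≤ n → isCompactDist a b V1 V2 n (P.map (X n))) (j : ℕ) :
    ∀ᵐ ω ∂P, Tendsto (fun n : ℕ => if h : j < n then X n ω ⟨j, h⟩ else 0) atTop
      (𝓝 (canMoment a b q (j + 1))) := by
  have h1 : ∀ᵐ ω ∂P, ∀ n, 1 ≤ n → ∃ u ∈ openCube n, momentMap a b n u = X n ω :=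
    ae_all_iff.2 fun n => by
      by_cases hn : 1 ≤ n
      · filter_upwards [ae_mem_image_openCube hab (hX n) (hlaw n hn)] with ω hω _ using hω
      · exact Eventually.of_forall fun ω h => absurd h hn
  have h2 : ∀ᵐ ω ∂P, ∀ i m : ℕ, ∀ᶠ n in atTop, ∀ u ∈ openCube n, momentMap a b n u = X n ω →
      |extend u i - q i| < 1 / ((m : ℝ) + 1) :=
    ae_all_iff.2 fun i => ae_all_iff.2 fun m =>
      ae_eventually_abs_extend_sub_lt hab hV1 hV2 (hq i) (hmin i) hX hlaw (by positivity)
  filter_upwards [h1, h2] with ω hω1 hω2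
  choose! u hu huX using hω1
  have hlim : Tendsto (fun n => extend (u n)) atTop (𝓝 q) := by
    rw [tendsto_pi_nhds]
    intro i
    rw [Metric.tendsto_nhds]
    intro ε hε
    obtain ⟨m, hm⟩ := exists_nat_one_div_lt hε
    filter_upwards [hω2 i m, eventually_ge_atTop 1] with n hn hn1
    exact (hn _ (hu n hn1) (huX n hn1)).trans hm
  refine (((continuous_canMoment a b (j + 1)).tendsto q).comp hlim).congr' ?_
  filter_upwards [eventually_gt_atTop j] with n hn
  rw [dif_pos hn, ← huX n (by omega)]
  rfl

lemma abs_canMoment_le {a b : ℝ} (hab : a < b) {p : ℕ → ℝ}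
    (hp : ∀ i, p i ∈ Set.Icc (0 : ℝ) 1) (j : ℕ) : |canMoment a b p j| ≤ max |a| |b| ^ j := by
  obtain ⟨μ, hμ, h0, hm⟩ := exists_measure hab hp j
  rw [← hm j le_rfl, ← Real.norm_eq_abs]
  have hae : ∀ᵐ x ∂μ, ‖x ^ j‖ ≤ max |a| |b| ^ j := by
    have : ∀ᵐ x ∂μ, x ∈ Set.Icc a b := by rw [ae_iff]; exact h0
    filter_upwards [this] with x hx
    rw [norm_pow]
    exact pow_le_pow_left₀ (norm_nonneg _) (abs_le_max_abs_abs hx.1 hx.2) j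
  simpa using norm_integral_le_of_norm_le_const hae

lemma tendsto_integral_abs_sub_canMoment {a b : ℝ} (hab : a < b) {V1 V2 : ℝ → ℝ}
    {Ω : Type*} [MeasurableSpace Ω] {P : Measure Ω} [IsProbabilityMeasure P]
    {X : (n : ℕ) → Ω → (Fin n → ℝ)} (hX : ∀ n, Measurable (X n))
    (hlaw : ∀ n : ℕ, 1 ≤ n → isCompactDist a b V1 V2 n (P.map (X n))) {j : ℕ} {c : ℝ}
    (h : ∀ᵐ ω ∂P, Tendsto (fun n : ℕ => if h : j < n then X n ω ⟨j, h⟩ else 0) atTop (𝓝 c)) :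
    Tendsto (fun n : ℕ => ∫ ω, |(if h : j < n then X n ω ⟨j, h⟩ else 0) - c| ∂P) atTop (𝓝 0) := by
  have hlim := tendsto_integral_of_dominated_convergence
    (F := fun (n : ℕ) ω => |(if h : j < n then X n ω ⟨j, h⟩ else 0) - c|) (f := fun _ => 0) (μ := P)
    (fun _ => max |a| |b| ^ (j + 1) + |c|) (fun n => ?_) (integrable_const _) (fun n => ?_) ?_
  · simpa using hlim
  · refine Measurable.aestronglyMeasurable ?_
    split_ifs with hn
    · exact (((measurable_pi_apply _).comp (hX n)).sub_const c).abs
    · exact measurable_const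
  · by_cases hn : j < n
    · filter_upwards [ae_mem_image_openCube hab (hX n) (hlaw n (by omega))] with ω hω
      obtain ⟨u, hu, hux⟩ := hω
      rw [Real.norm_eq_abs, abs_abs, dif_pos hn, ← hux]
      exact (abs_sub _ _).trans (add_le_add_left
        (abs_canMoment_le hab (extend_mem_Icc hu) (j + 1)) _)
    · refine Eventually.of_forall fun ω => ?_
      rw [Real.norm_eq_abs, abs_abs, dif_neg hn, zero_sub, abs_neg]
      exact le_add_of_nonneg_left (by positivity)
  · filter_upwards [h] with ω hω
    simpa using (hω.sub_const c).abs

/-! ### Trigonometric integrals -/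

lemma sin_sq_div_mem_Icc (r θ : ℝ) :
    Real.sin θ ^ 2 / (1 + 2 * r * Real.cos θ + r ^ 2) ∈ Set.Icc (0 : ℝ) 1 := by
  have h : 1 + 2 * r * Real.cos θ + r ^ 2 = (r + Real.cos θ) ^ 2 + Real.sin θ ^ 2 := by
    linear_combination -(Real.sin_sq_add_cos_sq θ)
  rw [h]
  exact ⟨by positivity, div_le_one_of_le₀ (by nlinarith [sq_nonneg (r + Real.cos θ)])
    (by positivity)⟩

lemma integrableOn_sin_sq_div (r : ℝ) :
    IntegrableOn (fun θ => Real.sin θ ^ 2 / (1 + 2 * r * Real.cos θ + r ^ 2)) (Set.Ioo 0 π) := by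
  refine Measure.integrableOn_of_bounded (M := 1) (by simp)
    (Measurable.aestronglyMeasurable (by fun_prop)) (Eventually.of_forall fun θ => ?_)
  have := sin_sq_div_mem_Icc r θ
  rw [Real.norm_of_nonneg this.1]
  exact this.2

lemma sq_sin_div_one_add_mul_cos {e θ : ℝ} (he : e ^ 2 = 1) (hθ : θ ∈ Set.Ioo 0 π) :
    Real.sin θ ^ 2 / (1 + 2 * e * Real.cos θ + e ^ 2) = (1 - e * Real.cos θ) / 2 := by
  have hs := Real.sin_pos_of_mem_Ioo hθ
  have h2 : (1 - e * Real.cos θ) * (1 + e * Real.cos θ) = Real.sin θ ^ 2 := by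
    linear_combination (-Real.cos θ ^ 2) * he - Real.sin_sq_add_cos_sq θ
  have hne : 1 + e * Real.cos θ ≠ 0 := fun h0 => by
    rw [h0, mul_zero] at h2
    exact (pow_pos hs 2).ne h2
  have hne' : 1 + 2 * e * Real.cos θ + e ^ 2 ≠ 0 := fun h0 => hne (by linarith)
  rw [div_eq_div_iff hne' two_ne_zero, ← h2, he]
  ring

lemma integral_sin_sq_div_of_sq_eq_one {e : ℝ} (he : e ^ 2 = 1) :
    ∫ θ in Set.Ioo 0 π, Real.sin θ ^ 2 / (1 + 2 * e * Real.cos θ + e ^ 2) = π / 2 := by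
  rw [setIntegral_congr_fun measurableSet_Ioo fun θ hθ => sq_sin_div_one_add_mul_cos he hθ,
    ← integral_Ioc_eq_integral_Ioo, ← intervalIntegral.integral_of_le Real.pi_pos.le]
  simp

lemma integral_sin_sq_div_of_lt {r : ℝ} (hr : r ≠ 0) (hr1 : |r| < 1) :
    ∫ θ in Set.Ioo 0 π, Real.sin θ ^ 2 / (1 + 2 * r * Real.cos θ + r ^ 2) = π / 2 := by
  have hr2 := abs_lt.1 hr1
  have hcos : ∀ θ, 0 < 1 + r * Real.cos θ := fun θ => by
    have h : |r * Real.cos θ| < 1 := by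
      rw [abs_mul]
      exact (mul_le_of_le_one_right (abs_nonneg _) (Real.abs_cos_le_one θ)).trans_lt hr1
    linarith [(abs_lt.1 h).1]
  have hden : ∀ θ, 0 < 1 + 2 * r * Real.cos θ + r ^ 2 := fun θ => by
    have h : 1 + 2 * r * Real.cos θ + r ^ 2 =
        (1 + r * Real.cos θ) ^ 2 + (r * Real.sin θ) ^ 2 := by
      linear_combination (-r ^ 2) * Real.sin_sq_add_cos_sq θ
    rw [h]
    have := hcos θ
    positivity
  have hderiv : ∀ θ, HasDerivAt (fun θ => -Real.sin θ / (2 * r) + θ / 2 +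
      (1 - r ^ 2) / (2 * r ^ 2) * Real.arctan (r * Real.sin θ / (1 + r * Real.cos θ)))
      (Real.sin θ ^ 2 / (1 + 2 * r * Real.cos θ + r ^ 2)) θ := fun θ => by
    have h1 := ((Real.hasDerivAt_sin θ).const_mul r).fun_div
      (((Real.hasDerivAt_cos θ).const_mul r).const_add 1) (hcos θ).ne'
    have h2 := (((Real.hasDerivAt_sin θ).fun_neg.div_const (2 * r)).fun_add
      ((hasDerivAt_id' θ).div_const 2)).fun_add (h1.arctan.const_mul ((1 - r ^ 2) / (2 * r ^ 2)))
    refine h2.congr_deriv ?_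
    have e1 := (hcos θ).ne'
    have e2 := (hden θ).ne'
    have e3 : 1 + (r * Real.sin θ / (1 + r * Real.cos θ)) ^ 2 =
        (1 + 2 * r * Real.cos θ + r ^ 2) / (1 + r * Real.cos θ) ^ 2 := by
      field_simp
      linear_combination r ^ 2 * Real.sin_sq_add_cos_sq θ
    have e4 : r * Real.cos θ * (1 + r * Real.cos θ) - r * Real.sin θ * (r * -Real.sin θ) =
        r * (Real.cos θ + r) := by
      linear_combination r ^ 2 * Real.sin_sq_add_cos_sq θ
    rw [e3, e4, Real.sin_sq, one_div_div, div_mul_div_cancel₀' (pow_ne_zero 2 e1), eq_div_iff e2,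
      add_mul, mul_assoc _ (_ / _), div_mul_cancel₀ _ e2]
    field_simp
    ring
  rw [← integral_Ioc_eq_integral_Ioo, ← intervalIntegral.integral_of_le Real.pi_pos.le,
    intervalIntegral.integral_eq_sub_of_hasDerivAt fun θ _ => hderiv θ]
  · simp
  · exact Continuous.intervalIntegrable (Continuous.div (by fun_prop) (by fun_prop)
      fun θ => (hden θ).ne') _ _

lemma integral_sin_sq_div {A B σ : ℝ} (hA : 0 < A) (hB : 0 < B) (hσ : σ ^ 2 = A * B) :
    IntegrableOn (fun θ => Real.sin θ ^ 2 / (A + B + 2 * σ * Real.cos θ)) (Set.Ioo 0 π) ∧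
      ∫ θ in Set.Ioo 0 π, Real.sin θ ^ 2 / (A + B + 2 * σ * Real.cos θ) =
        π / (2 * max A B) := by
  wlog hBA : B ≤ A generalizing A B
  · have := this hB hA (by rw [hσ, mul_comm]) (le_of_not_ge hBA)
    rwa [add_comm B A, max_comm] at this
  have hr : ∀ θ, Real.sin θ ^ 2 / (A + B + 2 * σ * Real.cos θ) =
      A⁻¹ * (Real.sin θ ^ 2 / (1 + 2 * (σ / A) * Real.cos θ + (σ / A) ^ 2)) := fun θ => by
    have : A + B + 2 * σ * Real.cos θ =
        A * (1 + 2 * (σ / A) * Real.cos θ + (σ / A) ^ 2) := by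
      rw [div_pow, hσ]
      field_simp
      ring
    rw [this, ← div_div, div_eq_inv_mul (Real.sin θ ^ 2) A, mul_div_assoc]
  have hρ0 : σ / A ≠ 0 := div_ne_zero (fun h => by
    rw [h] at hσ
    have := mul_pos hA hB
    linarith) hA.ne'
  have hρ1 : (σ / A) ^ 2 ≤ 1 := by
    rw [div_pow, hσ, div_le_one (by positivity)]
    nlinarith
  simp only [hr]
  refine ⟨(integrableOn_sin_sq_div _).const_mul _, ?_⟩
  have hval : ∫ θ in Set.Ioo 0 π,
      Real.sin θ ^ 2 / (1 + 2 * (σ / A) * Real.cos θ + (σ / A) ^ 2) = π / 2 := by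
    rcases hρ1.lt_or_eq with h | h
    · exact integral_sin_sq_div_of_lt hρ0 (by rwa [← sq_lt_one_iff_abs_lt_one])
    · exact integral_sin_sq_div_of_sq_eq_one h
  rw [integral_const_mul, hval, max_eq_left hBA]
  field_simp

lemma integral_sin_mul_sin (k : ℕ) :
    ∫ θ in Set.Ioo 0 π, Real.sin ((k + 1 : ℕ) * θ) * Real.sin θ = if k = 0 then π / 2 else 0 := by
  rw [← integral_Ioc_eq_integral_Ioo, ← intervalIntegral.integral_of_le Real.pi_pos.le]
  split_ifs with hk
  · subst hk
    simp [← sq]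
  · have hprod : ∀ θ : ℝ, Real.sin ((k + 1 : ℕ) * θ) * Real.sin θ =
        (Real.cos (k * θ) - Real.cos ((k + 2 : ℕ) * θ)) / 2 := fun θ => by
      have h1 : (k : ℝ) * θ = (k + 1 : ℕ) * θ - θ := by push_cast; ring
      have h2 : ((k + 2 : ℕ) : ℝ) * θ = (k + 1 : ℕ) * θ + θ := by push_cast; ring
      rw [h1, h2, Real.cos_sub, Real.cos_add]
      ring
    have hcos : ∀ m : ℕ, m ≠ 0 → ∫ θ in (0 : ℝ)..π, Real.cos (m * θ) = 0 := fun m hm => by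
      rw [intervalIntegral.integral_comp_mul_left (fun θ => Real.cos θ) (Nat.cast_ne_zero.2 hm)]
      simp [Real.sin_nat_mul_pi]
    simp only [hprod]
    rw [intervalIntegral.integral_div, intervalIntegral.integral_sub
      (Continuous.intervalIntegrable (by fun_prop) _ _)
      (Continuous.intervalIntegrable (by fun_prop) _ _), hcos k hk, hcos (k + 2) (by omega)]
    simp

/-! ### Arc parametrization of the limiting measure -/

/-- Half of the amplitude of `arcPoint`. -/
def arcRadius (p1 p2 : ℝ) : ℝ := √(p1 * (1 - p2)) * √(p2 * (1 - p1))

/-- The parametrization of the support of the absolutely continuous part of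
`muCompact 0 1 p1 p2` by an angle in `(0, π)`. -/
def arcPoint (p1 p2 θ : ℝ) : ℝ :=
  p1 * (1 - p2) + p2 * (1 - p1) + 2 * arcRadius p1 p2 * Real.cos θ

/-- The density of the absolutely continuous part of `muCompact` in the angle. -/
def arcDensity (p1 p2 θ : ℝ) : ℝ :=
  2 * arcRadius p1 p2 ^ 2 / (π * p2) *
    (Real.sin θ ^ 2 / arcPoint p1 p2 θ + Real.sin θ ^ 2 / (1 - arcPoint p1 p2 θ))

lemma arcRadius_pos {p1 p2 : ℝ} (hp1 : p1 ∈ Set.Ioo (0 : ℝ) 1)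
    (hp2 : p2 ∈ Set.Ioo (0 : ℝ) 1) : 0 < arcRadius p1 p2 :=
  mul_pos (Real.sqrt_pos.2 (mul_pos hp1.1 (sub_pos.2 hp2.2)))
    (Real.sqrt_pos.2 (mul_pos hp2.1 (sub_pos.2 hp1.2)))

lemma arcRadius_sq {p1 p2 : ℝ} (hp1 : p1 ∈ Set.Ioo (0 : ℝ) 1)
    (hp2 : p2 ∈ Set.Ioo (0 : ℝ) 1) : arcRadius p1 p2 ^ 2 = p1 * (1 - p2) * (p2 * (1 - p1)) := by
  rw [arcRadius, mul_pow, Real.sq_sqrt (mul_pos hp1.1 (sub_pos.2 hp2.2)).le,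
    Real.sq_sqrt (mul_pos hp2.1 (sub_pos.2 hp1.2)).le]

lemma lmin_eq {p1 p2 : ℝ} (hp1 : p1 ∈ Set.Ioo (0 : ℝ) 1)
    (hp2 : p2 ∈ Set.Ioo (0 : ℝ) 1) (a b : ℝ) : lmin a b p1 p2 =
    a + (b - a) * (p1 * (1 - p2) + p2 * (1 - p1) - 2 * arcRadius p1 p2) := by
  rw [lmin, sub_sq, Real.sq_sqrt (mul_pos hp1.1 (sub_pos.2 hp2.2)).le,
    Real.sq_sqrt (mul_pos hp2.1 (sub_pos.2 hp1.2)).le, arcRadius]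
  ring

lemma lmax_eq {p1 p2 : ℝ} (hp1 : p1 ∈ Set.Ioo (0 : ℝ) 1)
    (hp2 : p2 ∈ Set.Ioo (0 : ℝ) 1) (a b : ℝ) : lmax a b p1 p2 =
    a + (b - a) * (p1 * (1 - p2) + p2 * (1 - p1) + 2 * arcRadius p1 p2) := by
  rw [lmax, add_sq, Real.sq_sqrt (mul_pos hp1.1 (sub_pos.2 hp2.2)).le,
    Real.sq_sqrt (mul_pos hp2.1 (sub_pos.2 hp1.2)).le, arcRadius]
  ring

lemma two_mul_arcRadius_le {p1 p2 : ℝ} (hp1 : p1 ∈ Set.Ioo (0 : ℝ) 1)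
    (hp2 : p2 ∈ Set.Ioo (0 : ℝ) 1) : 2 * arcRadius p1 p2 ≤ p1 * (1 - p2) + p2 * (1 - p1) := by
  have h1 := mul_pos hp1.1 (sub_pos.2 hp2.2)
  have h2 := mul_pos hp2.1 (sub_pos.2 hp1.2)
  refine abs_le_of_sq_le_sq' ?_ (by positivity) |>.2
  rw [mul_pow, arcRadius_sq hp1 hp2]
  nlinarith [sq_nonneg (p1 * (1 - p2) - p2 * (1 - p1))]

lemma two_mul_arcRadius_le' {p1 p2 : ℝ} (hp1 : p1 ∈ Set.Ioo (0 : ℝ) 1)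
    (hp2 : p2 ∈ Set.Ioo (0 : ℝ) 1) : 2 * arcRadius p1 p2 ≤ p1 * p2 + (1 - p1) * (1 - p2) := by
  have h1 := mul_pos hp1.1 hp2.1
  have h2 := mul_pos (sub_pos.2 hp1.2) (sub_pos.2 hp2.2)
  refine abs_le_of_sq_le_sq' ?_ (by positivity) |>.2
  rw [mul_pow, arcRadius_sq hp1 hp2]
  nlinarith [sq_nonneg (p1 * p2 - (1 - p1) * (1 - p2))]

lemma arcPoint_mem_Ioo {p1 p2 : ℝ} (hp1 : p1 ∈ Set.Ioo (0 : ℝ) 1)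
    (hp2 : p2 ∈ Set.Ioo (0 : ℝ) 1) {θ : ℝ} (hθ : θ ∈ Set.Ioo 0 π) :
    arcPoint p1 p2 θ ∈ Set.Ioo (0 : ℝ) 1 := by
  have hr := arcRadius_pos hp1 hp2
  have h1 := two_mul_arcRadius_le hp1 hp2
  have h2 := two_mul_arcRadius_le' hp1 hp2
  have hs := Real.sin_pos_of_mem_Ioo hθ
  have hc := Real.sin_sq_add_cos_sq θ
  have hc1 : -1 < Real.cos θ := by nlinarith [Real.neg_one_le_cos θ]
  have hc2 : Real.cos θ < 1 := by nlinarith [Real.cos_le_one θ]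
  constructor <;> unfold arcPoint <;> nlinarith

lemma arcDensity_eq {p1 p2 : ℝ} (hp1 : p1 ∈ Set.Ioo (0 : ℝ) 1)
    (hp2 : p2 ∈ Set.Ioo (0 : ℝ) 1) {θ : ℝ} (hθ : θ ∈ Set.Ioo 0 π) : arcDensity p1 p2 θ =
    2 * arcRadius p1 p2 ^ 2 * Real.sin θ ^ 2 /
      (π * p2 * (arcPoint p1 p2 θ * (1 - arcPoint p1 p2 θ))) := by
  obtain ⟨h0, h1⟩ := arcPoint_mem_Ioo hp1 hp2 hθ
  have h1' := (sub_pos.2 h1).ne'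
  have h2 := hp2.1.ne'
  have h0' := h0.ne'
  rw [arcDensity]
  field_simp
  ring

lemma integrableOn_arcDensity {p1 p2 : ℝ} (hp1 : p1 ∈ Set.Ioo (0 : ℝ) 1)
    (hp2 : p2 ∈ Set.Ioo (0 : ℝ) 1) : IntegrableOn (arcDensity p1 p2) (Set.Ioo 0 π) ∧
    ∫ θ in Set.Ioo 0 π, arcDensity p1 p2 θ =
      (min (p1 * (1 - p2)) (p2 * (1 - p1)) + min (p1 * p2) ((1 - p1) * (1 - p2))) / p2 ∧
    ∫ θ in Set.Ioo 0 π, arcPoint p1 p2 θ * arcDensity p1 p2 θ =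
      min (p1 * p2) ((1 - p1) * (1 - p2)) / p2 := by
  have hA := mul_pos hp1.1 (sub_pos.2 hp2.2)
  have hB := mul_pos hp2.1 (sub_pos.2 hp1.2)
  have hC := mul_pos hp1.1 hp2.1
  have hD := mul_pos (sub_pos.2 hp1.2) (sub_pos.2 hp2.2)
  have hr := arcRadius_sq hp1 hp2
  obtain ⟨i1, v1⟩ := integral_sin_sq_div hA hB hr
  obtain ⟨i2, v2⟩ := integral_sin_sq_div hC hD (σ := -arcRadius p1 p2) (by
    rw [neg_sq, hr]; ring)
  have e2 : (fun θ => Real.sin θ ^ 2 / (p1 * p2 + (1 - p1) * (1 - p2) +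
      2 * -arcRadius p1 p2 * Real.cos θ)) =
      fun θ => Real.sin θ ^ 2 / (1 - arcPoint p1 p2 θ) := by
    ext θ
    rw [arcPoint]
    congr 1
    ring
  rw [e2] at i2 v2
  change IntegrableOn (fun θ => Real.sin θ ^ 2 / arcPoint p1 p2 θ) _ at i1
  change ∫ θ in Set.Ioo 0 π, Real.sin θ ^ 2 / arcPoint p1 p2 θ = _ at v1
  have hmin : ∀ {x y : ℝ}, 0 < x → 0 < y → x * y = arcRadius p1 p2 ^ 2 →
      2 * arcRadius p1 p2 ^ 2 / (π * p2) * (π / (2 * max x y)) = min x y / p2 := by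
    intro x y hx hy hxy
    have hm : 0 < max x y := lt_max_of_lt_left hx
    have hp := hp2.1.ne'
    rw [← hxy, ← max_mul_min x y]
    field_simp
  have m1 := hmin hA hB hr.symm
  have m2 := hmin hC hD (by rw [hr]; ring)
  refine ⟨(i1.add i2).const_mul _, ?_, ?_⟩
  · simp only [arcDensity]
    rw [integral_const_mul, integral_add i1 i2, v1, v2, mul_add, m1, m2, add_div]
  · rw [setIntegral_congr_fun (g := fun θ => 2 * arcRadius p1 p2 ^ 2 / (π * p2) *
      (Real.sin θ ^ 2 / (1 - arcPoint p1 p2 θ))) measurableSet_Ioo fun θ hθ => ?_]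
    · rw [integral_const_mul, v2, m2]
    · obtain ⟨h0, h1⟩ := arcPoint_mem_Ioo hp1 hp2 hθ
      have h1' := (sub_pos.2 h1).ne'
      have h0' := h0.ne'
      simp only [arcDensity]
      field_simp
      ring

lemma image_arcPoint {a b p1 p2 : ℝ} (hab : a < b) (hp1 : p1 ∈ Set.Ioo (0 : ℝ) 1)
    (hp2 : p2 ∈ Set.Ioo (0 : ℝ) 1) :
    (fun θ => a + (b - a) * arcPoint p1 p2 θ) '' Set.Ioo 0 π =
      Set.Ioo (lmin a b p1 p2) (lmax a b p1 p2) := by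
  have hr := arcRadius_pos hp1 hp2
  have hd := sub_pos.2 hab
  rw [lmin_eq hp1 hp2, lmax_eq hp1 hp2]
  have hcomp : (fun θ => a + (b - a) * arcPoint p1 p2 θ) =
      (fun y => a + y) ∘ (fun y => (b - a) * y) ∘
        (fun y => p1 * (1 - p2) + p2 * (1 - p1) + y) ∘ (fun y => 2 * arcRadius p1 p2 * y) ∘
          Real.cos := rfl
  rw [hcomp]
  simp only [Set.image_comp]
  have hcos : Real.cos '' Set.Ioo 0 π = Set.Ioo (-1) 1 := by
    refine Set.Subset.antisymm ?_ fun y hy => ⟨Real.arccos y, ⟨Real.arccos_pos.2 hy.2, ?_⟩,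
      Real.cos_arccos hy.1.le hy.2.le⟩
    · rintro _ ⟨θ, hθ, rfl⟩
      have hs := Real.sin_pos_of_mem_Ioo hθ
      have hc := Real.sin_sq_add_cos_sq θ
      exact ⟨by nlinarith [Real.neg_one_le_cos θ], by nlinarith [Real.cos_le_one θ]⟩
    · refine lt_of_le_of_ne (Real.arccos_le_pi y) fun h => ?_
      rw [Real.arccos_eq_pi] at h
      exact (hy.1.trans_le h).false
  rw [hcos, Set.image_mul_left_Ioo (by positivity), Set.image_const_add_Ioo,
    Set.image_mul_left_Ioo hd, Set.image_const_add_Ioo]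
  congr 1 <;> ring

lemma hasDerivAt_arcPoint {a b p1 p2 : ℝ} (θ : ℝ) :
    HasDerivAt (fun θ => a + (b - a) * arcPoint p1 p2 θ)
      ((b - a) * (2 * arcRadius p1 p2 * -Real.sin θ)) θ :=
  ((((Real.hasDerivAt_cos θ).const_mul _).const_add _).const_mul _).const_add _

lemma injOn_arcPoint {a b p1 p2 : ℝ} (hab : a < b) (hp1 : p1 ∈ Set.Ioo (0 : ℝ) 1)
    (hp2 : p2 ∈ Set.Ioo (0 : ℝ) 1) :
    Set.InjOn (fun θ => a + (b - a) * arcPoint p1 p2 θ) (Set.Ioo 0 π) := by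
  have hr := arcRadius_pos hp1 hp2
  have hd := sub_pos.2 hab
  intro x hx y hy hxy
  refine Real.injOn_cos (Set.Ioo_subset_Icc_self hx) (Set.Ioo_subset_Icc_self hy) ?_
  simpa [arcPoint, hr.ne', hd.ne'] using hxy

lemma abs_deriv_mul_compactDensity {a b p1 p2 : ℝ} (hab : a < b) (hp1 : p1 ∈ Set.Ioo (0 : ℝ) 1)
    (hp2 : p2 ∈ Set.Ioo (0 : ℝ) 1) {θ : ℝ} (hθ : θ ∈ Set.Ioo 0 π) :
    |(b - a) * (2 * arcRadius p1 p2 * -Real.sin θ)| *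
      compactDensity a b p1 p2 (a + (b - a) * arcPoint p1 p2 θ) = arcDensity p1 p2 θ := by
  have hr := arcRadius_pos hp1 hp2
  have hd := sub_pos.2 hab
  have hs := Real.sin_pos_of_mem_Ioo hθ
  obtain ⟨h0, h1⟩ := arcPoint_mem_Ioo hp1 hp2 hθ
  have h1' := (sub_pos.2 h1).ne'
  have h0' := h0.ne'
  have hp := hp2.1.ne'
  have hmem : a + (b - a) * arcPoint p1 p2 θ ∈
      Set.Ioo (lmin a b p1 p2) (lmax a b p1 p2) := by
    rw [← image_arcPoint hab hp1 hp2]; exact Set.mem_image_of_mem _ hθ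
  have hsq : (a + (b - a) * arcPoint p1 p2 θ - lmin a b p1 p2) *
      (lmax a b p1 p2 - (a + (b - a) * arcPoint p1 p2 θ)) =
      ((b - a) * (2 * arcRadius p1 p2 * Real.sin θ)) ^ 2 := by
    rw [lmin_eq hp1 hp2, lmax_eq hp1 hp2, arcPoint]
    linear_combination (-(b - a) ^ 2 * 4 * arcRadius p1 p2 ^ 2) * Real.sin_sq_add_cos_sq θ
  rw [compactDensity, if_pos (Set.Ioo_subset_Icc_self hmem), hsq, Real.sqrt_sq (by positivity),
    mul_neg, mul_neg, abs_neg, abs_of_nonneg (by positivity), arcDensity_eq hp1 hp2 hθ]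
  have e1 : a + (b - a) * arcPoint p1 p2 θ - a = (b - a) * arcPoint p1 p2 θ := by ring
  have e2 : b - (a + (b - a) * arcPoint p1 p2 θ) = (b - a) * (1 - arcPoint p1 p2 θ) := by ring
  rw [e1, e2]
  field_simp

lemma compactDensity_eq_zero {a b p1 p2 x : ℝ}
    (hx : x ∉ Set.Icc (lmin a b p1 p2) (lmax a b p1 p2)) :
    compactDensity a b p1 p2 x = 0 := if_neg hx

lemma measurable_compactDensity {a b p1 p2 : ℝ} : Measurable (compactDensity a b p1 p2) :=
  Measurable.ite measurableSet_Icc (by fun_prop) measurable_const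

lemma compactDensity_nonneg {a b p1 p2 : ℝ} (hab : a < b) (hp1 : p1 ∈ Set.Ioo (0 : ℝ) 1)
    (hp2 : p2 ∈ Set.Ioo (0 : ℝ) 1) (x : ℝ) : 0 ≤ compactDensity a b p1 p2 x := by
  have hd := sub_pos.2 hab
  have h1 := two_mul_arcRadius_le hp1 hp2
  have h2 := two_mul_arcRadius_le' hp1 hp2
  rw [compactDensity]
  split_ifs with h
  · rw [lmin_eq hp1 hp2, lmax_eq hp1 hp2] at h
    have hp := hp2.1
    have ha : 0 ≤ x - a := by nlinarith [h.1]
    have hb : 0 ≤ b - x := by nlinarith [h.2]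
    positivity
  · rfl

lemma integrable_compactDensity {a b p1 p2 : ℝ} (hab : a < b) (hp1 : p1 ∈ Set.Ioo (0 : ℝ) 1)
    (hp2 : p2 ∈ Set.Ioo (0 : ℝ) 1) : Integrable (compactDensity a b p1 p2) := by
  rw [← integrableOn_iff_integrable_of_support_subset
    (s := Set.Icc (lmin a b p1 p2) (lmax a b p1 p2)) fun x hx => by
      by_contra h; exact hx (compactDensity_eq_zero h), integrableOn_Icc_iff_integrableOn_Ioo,
    ← image_arcPoint hab hp1 hp2, integrableOn_image_iff_integrableOn_abs_deriv_smul
      measurableSet_Ioo (fun θ _ => (hasDerivAt_arcPoint θ).hasDerivWithinAt)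
      (injOn_arcPoint hab hp1 hp2)]
  exact (integrableOn_arcDensity hp1 hp2).1.congr_fun
    (fun θ hθ => (abs_deriv_mul_compactDensity hab hp1 hp2 hθ).symm) measurableSet_Ioo

lemma muCompact_compl_Icc {a b p1 p2 : ℝ} (hab : a < b) (hp1 : p1 ∈ Set.Ioo (0 : ℝ) 1)
    (hp2 : p2 ∈ Set.Ioo (0 : ℝ) 1) : muCompact a b p1 p2 (Set.Icc a b)ᶜ = 0 := by
  have hd := sub_pos.2 hab
  have h1 := two_mul_arcRadius_le hp1 hp2
  have h2 := two_mul_arcRadius_le' hp1 hp2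
  have hc : volume.withDensity (fun x => ENNReal.ofReal (compactDensity a b p1 p2 x))
      (Set.Icc a b)ᶜ = 0 := by
    rw [withDensity_apply _ measurableSet_Icc.compl,
      setLIntegral_congr_fun (g := 0) measurableSet_Icc.compl fun x hx => ?_]
    · simp
    · simp only [Pi.zero_apply]
      rw [compactDensity_eq_zero fun h => hx ?_, ENNReal.ofReal_zero]
      rw [lmin_eq hp1 hp2, lmax_eq hp1 hp2] at h
      exact ⟨by nlinarith [h.1], by nlinarith [h.2]⟩
  simp [muCompact, hc, hab.le]

lemma isFiniteMeasure_muCompact {a b p1 p2 : ℝ} (hab : a < b) (hp1 : p1 ∈ Set.Ioo (0 : ℝ) 1)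
    (hp2 : p2 ∈ Set.Ioo (0 : ℝ) 1) : IsFiniteMeasure (muCompact a b p1 p2) := by
  have := isFiniteMeasure_withDensity_ofReal (integrable_compactDensity hab hp1 hp2).2
  have h1 := (Measure.dirac a).smul_finite (ENNReal.ofReal_ne_top (r := max (1 - p1 / p2) 0))
  have h2 := (Measure.dirac b).smul_finite
    (ENNReal.ofReal_ne_top (r := max ((p1 + p2 - 1) / p2) 0))
  unfold muCompact
  infer_instance

lemma integral_muCompact {a b p1 p2 : ℝ} (hab : a < b) (hp1 : p1 ∈ Set.Ioo (0 : ℝ) 1)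
    (hp2 : p2 ∈ Set.Ioo (0 : ℝ) 1) {f : ℝ → ℝ} (hf : Continuous f) :
    ∫ x, f x ∂(muCompact a b p1 p2) =
      (∫ θ in Set.Ioo 0 π, f (a + (b - a) * arcPoint p1 p2 θ) * arcDensity p1 p2 θ) +
        max (1 - p1 / p2) 0 * f a + max ((p1 + p2 - 1) / p2) 0 * f b := by
  have := isFiniteMeasure_muCompact hab hp1 hp2
  have hInt : Integrable f (muCompact a b p1 p2) :=
    integrable_of_measure_compl_eq_zero isCompact_Icc (muCompact_compl_Icc hab hp1 hp2) hf
  rw [muCompact] at hInt ⊢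
  rw [integral_add_measure hInt.left_of_add_measure hInt.right_of_add_measure,
    integral_add_measure hInt.left_of_add_measure.left_of_add_measure
      hInt.left_of_add_measure.right_of_add_measure, integral_smul_measure,
    integral_smul_measure, integral_dirac, integral_dirac,
    ENNReal.toReal_ofReal (le_max_right _ _), ENNReal.toReal_ofReal (le_max_right _ _),
    smul_eq_mul, smul_eq_mul,
    integral_withDensity_eq_integral_toReal_smul measurable_compactDensity.ennreal_ofReal
      (Eventually.of_forall fun _ => ENNReal.ofReal_lt_top)]
  simp only [ENNReal.toReal_ofReal (compactDensity_nonneg hab hp1 hp2 _), smul_eq_mul]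
  rw [← setIntegral_eq_integral_of_forall_compl_eq_zero
    (s := Set.Icc (lmin a b p1 p2) (lmax a b p1 p2)) fun x hx => by
      rw [compactDensity_eq_zero hx, zero_mul], integral_Icc_eq_integral_Ioo,
    ← image_arcPoint hab hp1 hp2, integral_image_eq_integral_abs_deriv_smul measurableSet_Ioo
      (fun θ _ => (hasDerivAt_arcPoint θ).hasDerivWithinAt) (injOn_arcPoint hab hp1 hp2),
    setIntegral_congr_fun measurableSet_Ioo fun θ hθ => by
      rw [smul_eq_mul, ← mul_assoc, abs_deriv_mul_compactDensity hab hp1 hp2 hθ, mul_comm]]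

lemma weight_right {p1 p2 : ℝ} (hp : 0 < p2) : max ((p1 + p2 - 1) / p2) 0 =
    (p1 * p2 - min (p1 * p2) ((1 - p1) * (1 - p2))) / p2 := by
  rw [eq_div_iff hp.ne', max_mul_of_nonneg _ _ hp.le, ← max_sub_sub_left, max_comm]
  congr 1
  · ring
  · field_simp; ring

lemma isProbabilityMeasure_muCompact {a b p1 p2 : ℝ} (hab : a < b) (hp1 : p1 ∈ Set.Ioo (0 : ℝ) 1)
    (hp2 : p2 ∈ Set.Ioo (0 : ℝ) 1) : IsProbabilityMeasure (muCompact a b p1 p2) := by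
  have := isFiniteMeasure_muCompact hab hp1 hp2
  have h := integral_muCompact hab hp1 hp2 (f := fun _ => 1) continuous_const
  simp only [one_mul, integral_const, smul_eq_mul, mul_one,
    (integrableOn_arcDensity hp1 hp2).2.1] at h
  have hp := hp2.1
  have e0 : max (1 - p1 / p2) 0 =
      (p2 * (1 - p1) - min (p1 * (1 - p2)) (p2 * (1 - p1))) / p2 := by
    rw [eq_div_iff hp.ne', max_mul_of_nonneg _ _ hp.le, ← max_sub_sub_left]
    congr 1
    · field_simp; ring
    · ring
  rw [e0, weight_right hp, ← add_div, ← add_div] at h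
  have : (muCompact a b p1 p2).real Set.univ = 1 := by
    rw [h, div_eq_one_iff_eq hp.ne']
    ring
  exact ⟨by rwa [measureReal_def, ENNReal.toReal_eq_one_iff] at this⟩

lemma integral_id_muCompact {p1 p2 : ℝ} (hp1 : p1 ∈ Set.Ioo (0 : ℝ) 1)
    (hp2 : p2 ∈ Set.Ioo (0 : ℝ) 1) : ∫ x, x ∂(muCompact 0 1 p1 p2) = p1 := by
  rw [integral_muCompact one_pos hp1 hp2 continuous_id']
  simp only [sub_zero, one_mul, zero_add, mul_zero, add_zero, mul_one,
    (integrableOn_arcDensity hp1 hp2).2.2]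
  have hp := hp2.1
  rw [weight_right hp, ← add_div, div_eq_iff hp.ne']
  ring

lemma integral_pow_muCompact {a b p1 p2 : ℝ} (hab : a < b) (hp1 : p1 ∈ Set.Ioo (0 : ℝ) 1)
    (hp2 : p2 ∈ Set.Ioo (0 : ℝ) 1) (j : ℕ) : ∫ x, x ^ j ∂(muCompact a b p1 p2) =
      affineMoment a b (fun i => ∫ x, x ^ i ∂(muCompact 0 1 p1 p2)) j := by
  have := isProbabilityMeasure_muCompact one_pos hp1 hp2
  rw [← integral_affine_pow isCompact_Icc (muCompact_compl_Icc one_pos hp1 hp2),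
    integral_muCompact hab hp1 hp2 (by fun_prop),
    integral_muCompact one_pos hp1 hp2 (by fun_prop)]
  simp only [zero_add, sub_zero, one_mul, mul_zero, mul_one, add_comm _ a, add_zero,
    add_sub_cancel]

/-! ### Moments of the limiting measure -/

lemma alternating_even (p1 p2 : ℝ) (k : ℕ) : alternating p1 p2 (2 * k) = p1 := by
  simp [alternating]

lemma alternating_odd (p1 p2 : ℝ) (k : ℕ) : alternating p1 p2 (2 * k + 1) = p2 := by
  simp [alternating, Nat.add_mod]

lemma dualPoly_alternating_even (p1 p2 : ℝ) (k : ℕ) :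
    dualPoly (alternating p1 p2) (2 * (k + 1)) =
      X * dualPoly (alternating p1 p2) (2 * k + 1) -
        C (p1 * (1 - p2)) * dualPoly (alternating p1 p2) (2 * k) := by
  rw [mul_add, mul_one, dualPoly, alternating_even, alternating_odd]

lemma dualPoly_alternating_odd (p1 p2 : ℝ) (k : ℕ) :
    dualPoly (alternating p1 p2) (2 * (k + 1) + 1) =
      X * dualPoly (alternating p1 p2) (2 * (k + 1)) -
        C (p2 * (1 - p1)) * dualPoly (alternating p1 p2) (2 * k + 1) := by
  have h := alternating_even p1 p2 (k + 1)
  rw [mul_add, mul_one] at h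
  rw [mul_add, mul_one, dualPoly, alternating_odd, show 2 * k + 1 + 1 = 2 * k + 2 from rfl, h]

lemma eval_dualPoly_alternating {p1 p2 : ℝ} (hp1 : p1 ∈ Set.Ioo (0 : ℝ) 1)
    (hp2 : p2 ∈ Set.Ioo (0 : ℝ) 1) {θ y : ℝ} (hy : y ^ 2 = arcPoint p1 p2 θ) (k : ℕ) :
    arcRadius p1 p2 * (dualPoly (alternating p1 p2) (2 * k)).eval y * Real.sin θ =
        arcRadius p1 p2 ^ k * (arcRadius p1 p2 * Real.sin ((k + 1 : ℕ) * θ) +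
          p2 * (1 - p1) * Real.sin (k * θ)) ∧
      (dualPoly (alternating p1 p2) (2 * k + 1)).eval y * Real.sin θ =
        y * arcRadius p1 p2 ^ k * Real.sin ((k + 1 : ℕ) * θ) := by
  induction k with
  | zero => simp [dualPoly]
  | succ k ih =>
    obtain ⟨h0, h1⟩ := ih
    have hr := arcRadius_pos hp1 hp2
    have hsq := arcRadius_sq hp1 hp2
    rw [arcPoint] at hy
    have hadd : Real.sin ((k + 1 + 1 : ℕ) * θ) + Real.sin (k * θ) =
        2 * Real.cos θ * Real.sin ((k + 1 : ℕ) * θ) := by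
      have e1 : ((k + 1 + 1 : ℕ) : ℝ) * θ = (k + 1 : ℕ) * θ + θ := by push_cast; ring
      have e2 : (k : ℝ) * θ = (k + 1 : ℕ) * θ - θ := by push_cast; ring
      rw [e1, e2, Real.sin_add, Real.sin_sub]
      ring
    have h2 : arcRadius p1 p2 * (dualPoly (alternating p1 p2) (2 * (k + 1))).eval y *
        Real.sin θ = arcRadius p1 p2 ^ (k + 1) *
          (arcRadius p1 p2 * Real.sin ((k + 1 + 1 : ℕ) * θ) +
            p2 * (1 - p1) * Real.sin ((k + 1 : ℕ) * θ)) := by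
      rw [dualPoly_alternating_even]
      simp only [eval_sub, eval_mul, eval_X, eval_C]
      linear_combination (arcRadius p1 p2 * y) * h1 - p1 * (1 - p2) * h0 +
        (arcRadius p1 p2 ^ (k + 1) * Real.sin ((k + 1 : ℕ) * θ)) * hy -
        arcRadius p1 p2 ^ (k + 2) * hadd +
        (arcRadius p1 p2 ^ k * Real.sin (k * θ)) * hsq
    refine ⟨h2, mul_left_cancel₀ hr.ne' ?_⟩
    rw [dualPoly_alternating_odd]
    simp only [eval_sub, eval_mul, eval_X, eval_C]
    linear_combination y * h2 - (arcRadius p1 p2 * (p2 * (1 - p1))) * h1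

lemma eval_neg_orthPoly (p : ℕ → ℝ) (y : ℝ) :
    ∀ n, (orthPoly p n).eval (-y) = (-1) ^ n * (orthPoly p n).eval y
  | 0 => by simp [orthPoly]
  | 1 => by simp [orthPoly]
  | n + 2 => by
    simp only [orthPoly, eval_sub, eval_mul, eval_X, eval_C, eval_neg_orthPoly p y (n + 1),
      eval_neg_orthPoly p y n]
    ring

lemma eq_momentFunctional_dyck {p : ℕ → ℝ} {L : ℝ[X] →ₗ[ℝ] ℝ} (h0 : L 1 = 1)
    (h : ∀ n, L (orthPoly p (n + 1)) = 0) : L = momentFunctional (dyck p · 0) := by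
  have key : ∀ n, ∀ f : ℝ[X], f.natDegree ≤ n → L f = momentFunctional (dyck p · 0) f := by
    have hone : momentFunctional (dyck p · 0) 1 = 1 := by
      simpa [dyck] using momentFunctional_X_pow (dyck p · 0) 0
    intro n
    induction n with
    | zero =>
      intro f hf
      rw [natDegree_eq_zero.1 (Nat.le_zero.1 hf) |>.choose_spec.symm, ← mul_one (C _),
        ← smul_eq_C_mul, map_smul, map_smul, h0, hone]
    | succ n ih =>
      intro f hf
      have hdeg : (f - C (f.coeff (n + 1)) * orthPoly p (n + 1)).natDegree ≤ n := by
        refine natDegree_le_iff_coeff_eq_zero.2 fun m hm => ?_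
        rw [coeff_sub, coeff_C_mul]
        rcases (Nat.succ_le_of_lt hm).eq_or_lt with rfl | hm'
        · have := orthPoly_monic p (n + 1)
          rw [Monic, leadingCoeff, orthPoly_natDegree] at this
          rw [Nat.succ_eq_add_one, this, mul_one, sub_self]
        · rw [coeff_eq_zero_of_natDegree_lt (p := f) (by omega),
            coeff_eq_zero_of_natDegree_lt (p := orthPoly p (n + 1))
              (by rw [orthPoly_natDegree]; omega), mul_zero, sub_zero]
      have hz := momentFunctional_mul_orthPoly_of_lt p (n := n + 1) (g := 1) (by simp)
      have := ih _ hdeg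
      rw [one_mul] at hz
      rwa [← smul_eq_C_mul, map_sub, map_sub, map_smul, map_smul, h, hz, smul_zero, sub_zero,
        sub_zero] at this
  exact LinearMap.ext fun f => key _ f le_rfl

lemma symMoment_muCompact {p1 p2 : ℝ} (hp1 : p1 ∈ Set.Ioo (0 : ℝ) 1)
    (hp2 : p2 ∈ Set.Ioo (0 : ℝ) 1) :
    momentFunctional (symMoment fun i => ∫ x, x ^ i ∂(muCompact 0 1 p1 p2)) =
      momentFunctional (dyck (alternating p1 p2) · 0) := by
  have hprob := isProbabilityMeasure_muCompact one_pos hp1 hp2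
  have hInt := momentFunctional_symMoment_eq_integral (muCompact_compl_Icc one_pos hp1 hp2)
  set N := momentFunctional (symMoment fun i => ∫ x, x ^ i ∂(muCompact 0 1 p1 p2)) with hN
  set Q := orthPoly (alternating p1 p2)
  set S := dualPoly (alternating p1 p2)
  have hone : N 1 = 1 := by simp [hInt]
  have hXsq : N (X ^ 2) = p1 := by
    rw [hN, momentFunctional_X_pow]
    simpa [symMoment] using integral_id_muCompact hp1 hp2
  have hodd : ∀ k, N (X * ((X ^ 2 - 1) * S (2 * k + 1))) =
      if k = 0 then -(p1 * (1 - p1) * (1 - p2)) else 0 := fun k => by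
    have hp := hp2.1.ne'
    rw [hInt, integral_muCompact one_pos hp1 hp2 (by fun_prop),
      setIntegral_congr_fun (g := fun θ => -(2 * arcRadius p1 p2 ^ 2 / (π * p2) *
        arcRadius p1 p2 ^ k) * (Real.sin ((k + 1 : ℕ) * θ) * Real.sin θ)) measurableSet_Ioo
        fun θ hθ => ?_]
    · rw [integral_const_mul, integral_sin_mul_sin]
      split_ifs with hk
      · simp [hk, arcRadius_sq hp1 hp2]
        field_simp
      · simp
    · have hs := Real.sin_pos_of_mem_Ioo hθ
      have hx := arcPoint_mem_Ioo hp1 hp2 hθ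
      have hx0 := hx.1.ne'
      have hx1 := (sub_pos.2 hx.2).ne'
      have hev : ∀ y : ℝ, y ^ 2 = arcPoint p1 p2 θ →
          (X * ((X ^ 2 - 1) * S (2 * k + 1))).eval y = -(arcPoint p1 p2 θ *
            (1 - arcPoint p1 p2 θ)) * arcRadius p1 p2 ^ k * Real.sin ((k + 1 : ℕ) * θ) /
              Real.sin θ := fun y hy => by
        rw [eq_div_iff hs.ne']
        simp only [eval_mul, eval_X, eval_sub, eval_pow, eval_one]
        have := (eval_dualPoly_alternating hp1 hp2 hy k).2
        rw [← hy]
        linear_combination (y * (y ^ 2 - 1)) * this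
      simp only [zero_add, sub_zero, one_mul]
      rw [hev _ (Real.sq_sqrt hx.1.le), hev _ (by rw [neg_sq, Real.sq_sqrt hx.1.le]),
        arcDensity_eq hp1 hp2 hθ]
      field_simp
      ring
  have hE : ∀ k, N ((X ^ 2 - 1) * S (2 * k)) = if k = 0 then p1 - 1 else 0 := fun k => by
    have hrec : ∀ k, N ((X ^ 2 - 1) * S (2 * (k + 1))) =
        N (X * ((X ^ 2 - 1) * S (2 * k + 1))) -
          p1 * (1 - p2) * N ((X ^ 2 - 1) * S (2 * k)) := fun k => by
      rw [← smul_eq_mul (p1 * (1 - p2)), ← map_smul, ← map_sub, smul_eq_C_mul,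
        show S (2 * (k + 1)) = _ from dualPoly_alternating_even p1 p2 k]
      congr 1
      ring
    have h0 : N ((X ^ 2 - 1) * S (2 * 0)) = p1 - 1 := by
      simp [S, dualPoly, map_sub, hXsq, hone]
    induction k with
    | zero => rw [h0, if_pos rfl]
    | succ k ih =>
      rw [hrec, hodd, ih, if_neg k.succ_ne_zero]
      split_ifs <;> ring
  have hD : ∀ k, N (Q (2 * (k + 1))) = 0 := fun k => by
    induction k with
    | zero =>
      have h := hE 0
      rw [mul_zero, dualPoly_zero_mul, ← smul_eq_C_mul, map_sub, map_smul] at h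
      have h1 : N (Q 0) = 1 := hone
      rw [h1] at h
      have h2 : alternating p1 p2 0 = p1 := alternating_even p1 p2 0
      rw [h2, if_pos rfl, smul_eq_mul, mul_one] at h
      change N (Q 2) = 0
      linarith
    | succ k ih =>
      have h := hE (k + 1)
      rw [if_neg k.succ_ne_zero, mul_add, mul_one, dualPoly_succ_mul, ← smul_eq_C_mul, map_sub,
        map_smul] at h
      change N (Q (2 * k + 2)) = 0 at ih
      change N (Q (2 * k + 4)) - _ • N (Q (2 * k + 2)) = 0 at h
      rw [ih, smul_zero, sub_zero] at h
      exact h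
  refine eq_momentFunctional_dyck hone fun n => ?_
  rcases Nat.even_or_odd' (n + 1) with ⟨k, hk | hk⟩
  · obtain ⟨k, rfl⟩ : ∃ l, k = l + 1 := ⟨k - 1, by omega⟩
    rw [hk]
    exact hD k
  · rw [hk, hInt]
    simp [eval_neg_orthPoly, pow_succ, pow_mul]

lemma integral_pow_muCompact_eq_canMoment {a b : ℝ} (hab : a < b) {p1 p2 : ℝ}
    (hp1 : p1 ∈ Set.Ioo (0 : ℝ) 1) (hp2 : p2 ∈ Set.Ioo (0 : ℝ) 1) (j : ℕ) :
    ∫ x, x ^ j ∂(muCompact a b p1 p2) = canMoment a b (alternating p1 p2) j := by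
  rw [integral_pow_muCompact hab hp1 hp2, canMoment]
  refine affineMoment_congr fun i _ => ?_
  have h := congrArg (fun L => L (X ^ (2 * i))) (symMoment_muCompact hp1 hp2)
  simp only [momentFunctional_X_pow] at h
  simpa [symMoment, unitMoment] using h

end CanonicalMoments

/-- Law of large numbers on `M_n([a,b])`: if `X^(n) ~ ℙ_{n,[a,b],V₁,V₂}`
and `W_i = V_i - log(p(1-p))` have unique minimizers `p_i* ∈ (0,1)`, then for every fixed
`k ≥ 1` the first `k` coordinates of `X^(n)` converge, almost surely and in `L¹`, to the
first `k` moments of the measure `μ_{a,b,p1*,p2*}`. -/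
theorem statement0 (a b : ℝ) (hab : a < b) (V1 V2 : ℝ → ℝ)
    (hV1c : ContinuousOn V1 (Set.Icc 0 1)) (hV1d : ContDiffOn ℝ 2 V1 (Set.Ioo 0 1))
    (hV2c : ContinuousOn V2 (Set.Icc 0 1)) (hV2d : ContDiffOn ℝ 2 V2 (Set.Ioo 0 1))
    (p1s p2s : ℝ) (hp1 : p1s ∈ Set.Ioo (0 : ℝ) 1) (hp2 : p2s ∈ Set.Ioo (0 : ℝ) 1)
    (hmin1 : ∀ p ∈ Set.Ioo (0 : ℝ) 1, p ≠ p1s →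
      V1 p1s - Real.log (p1s * (1 - p1s)) < V1 p - Real.log (p * (1 - p)))
    (hmin2 : ∀ p ∈ Set.Ioo (0 : ℝ) 1, p ≠ p2s →
      V2 p2s - Real.log (p2s * (1 - p2s)) < V2 p - Real.log (p * (1 - p)))
    (Ω : Type) [MeasurableSpace Ω] (P : Measure Ω) [IsProbabilityMeasure P]
    (X : (n : ℕ) → Ω → (Fin n → ℝ)) (hX : ∀ n, Measurable (X n))
    (hlaw : ∀ n : ℕ, 1 ≤ n → isCompactDist a b V1 V2 n (P.map (X n)))
    (k : ℕ) (hk : 1 ≤ k) :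
    (∀ᵐ ω ∂P, ∀ j : Fin k,
      Tendsto (fun n : ℕ => if h : (j : ℕ) < n then X n ω ⟨(j : ℕ), h⟩ else 0) atTop
        (𝓝 (∫ x, x ^ ((j : ℕ) + 1) ∂(muCompact a b p1s p2s)))) ∧
    (∀ j : Fin k,
      Tendsto (fun n : ℕ => ∫ ω, |(if h : (j : ℕ) < n then X n ω ⟨(j : ℕ), h⟩ else 0)
          - ∫ x, x ^ ((j : ℕ) + 1) ∂(muCompact a b p1s p2s)| ∂P) atTop (𝓝 0)) := by
  have hq : ∀ i, CanonicalMoments.alternating p1s p2s i ∈ Set.Ioo (0 : ℝ) 1 := fun i => by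
    unfold CanonicalMoments.alternating
    split_ifs
    exacts [hp1, hp2]
  have hmin : ∀ i, ∀ p ∈ Set.Ioo (0 : ℝ) 1, p ≠ CanonicalMoments.alternating p1s p2s i →
      CanonicalMoments.potential V1 V2 i (CanonicalMoments.alternating p1s p2s i) -
          Real.log (CanonicalMoments.alternating p1s p2s i *
            (1 - CanonicalMoments.alternating p1s p2s i)) <
        CanonicalMoments.potential V1 V2 i p - Real.log (p * (1 - p)) := fun i => by
    unfold CanonicalMoments.alternating CanonicalMoments.potential
    split_ifs
    exacts [hmin1, hmin2]
  have hlim := CanonicalMoments.ae_tendsto_canMoment hab hV1c hV2c hq hmin hX hlaw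
  simp only [CanonicalMoments.integral_pow_muCompact_eq_canMoment hab hp1 hp2]
  exact ⟨ae_all_iff.2 fun j => hlim j, fun j =>
    CanonicalMoments.tendsto_integral_abs_sub_canMoment hab hX hlaw (hlim j)⟩

end
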